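/- arXiv:1805.04341 — 2 statements merged into one kernel-verified Lean document; each statement's English description precedes it below -/
import Mathlib

section
/- Let u(n) := max_{w ∈ S_n} Υ_w. Then liminf_{n→∞} (1/n²)·log u(n) ≥ γ, where γ := f(α)/(1−α²) and α is the unique solution in (0,1) of 2x·f(x) + (1−x²)·f′(x) = 0. (Numerically, γ/log 2 ≈ 0.2932, improving the lower bound 1/4 in base-2 logarithms.) -/
/-- The simple transposition `sᵢ = (i, i+1)` acting on `ℕ` (positions are 1-indexed,
so a permutation of `{1,…,n}` is modeled as a permutation of `ℕ` fixing `0` and all `i > n`). -/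
def sT (i : ℕ) : Equiv.Perm ℕ := Equiv.swap i (i + 1)

/-- The number of inversions `ℓ(w)` of `w` on `{1,…,n}`. -/
def len (n : ℕ) (w : Equiv.Perm ℕ) : ℕ :=
  ((Finset.Icc 1 n ×ˢ Finset.Icc 1 n).filter
    (fun p => p.1 < p.2 ∧ w p.2 < w p.1)).card

open scoped Classical in
/-- Macdonald's identity form of the principal specialization `𝔖_w(1,…,1)` of the
Schubert polynomial: `Υ_w = (1/ℓ!) ⬝ Σ_{(a₁,…,a_ℓ) ∈ R(w)} a₁ a₂ ⋯ a_ℓ`, where the sum is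
over reduced words of `w`, i.e. tuples with `1 ≤ aᵢ ≤ n − 1` and `w = s_{a₁} ⋯ s_{a_ℓ}`. -/
noncomputable def Upsilon (n : ℕ) (w : Equiv.Perm ℕ) : ℚ :=
  ((len n w).factorial : ℚ)⁻¹ *
    ∑ a ∈ Finset.univ.filter (fun a : Fin (len n w) → Fin n =>
        (∀ i, 1 ≤ (a i : ℕ)) ∧ (List.ofFn fun i => sT ((a i : ℕ))).prod = w),
      ∏ i, ((a i : ℕ) : ℚ)

/-- `S_n`: permutations of `{1,…,n}`, modeled as permutations of `ℕ`
fixing `0` and every `i > n`. -/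
def SymmOn (n : ℕ) : Set (Equiv.Perm ℕ) :=
  {w | ∀ i : ℕ, i = 0 ∨ n < i → w i = i}

/-- `u(n) = max_{w ∈ Sₙ} Υ_w` (as a real number; the set is finite and nonempty,
so the supremum is attained). -/
noncomputable def u (n : ℕ) : ℝ :=
  sSup ((fun w => ((Upsilon n w : ℚ) : ℝ)) '' SymmOn n)

/-- The function `f(x) = x² log x − ½(1−x)² log(1−x) − ½(1+x)² log(1+x) + 2x log 2`
(natural logarithms; `Real.log 0 = 0` gives the continuous extension `f 0 = f 1 = 0`). -/
noncomputable def f (x : ℝ) : ℝ :=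
  x ^ 2 * Real.log x - (1 / 2) * (1 - x) ^ 2 * Real.log (1 - x)
    - (1 / 2) * (1 + x) ^ 2 * Real.log (1 + x) + 2 * x * Real.log 2

open scoped Classical in
/-- The coefficient of `w` in `(∑ i ∈ J, i • sᵢ) ^ ℓ` in the group algebra: the sum of
`a₁ ⋯ a_ℓ` over the words of length `ℓ` in the alphabet `J` with product `w`. -/
noncomputable def wordSum (J : Finset ℕ) : ℕ → Equiv.Perm ℕ → ℚ
  | 0, w => if w = 1 then 1 else 0
  | l + 1, w => ∑ i ∈ J, (i : ℚ) * wordSum J l (sT i * w)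

theorem sT_mul_self (i : ℕ) : sT i * sT i = 1 := Equiv.swap_mul_self _ _

theorem sT_apply_of_ne {i x : ℕ} (h : x ≠ i) (h' : x ≠ i + 1) : sT i x = x :=
  Equiv.swap_apply_of_ne_of_ne h h'

theorem wordSum_nonneg (J : Finset ℕ) (l : ℕ) (w : Equiv.Perm ℕ) : 0 ≤ wordSum J l w := by
  induction l generalizing w with
  | zero => rw [wordSum]; split_ifs <;> norm_num
  | succ l ih => exact Finset.sum_nonneg fun i _ => mul_nonneg (Nat.cast_nonneg _) (ih _)

open scoped Classical in
theorem sum_words_eq_wordSum (n l : ℕ) (w : Equiv.Perm ℕ) :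
    ∑ a ∈ Finset.univ.filter (fun a : Fin l → Fin n =>
        (∀ i, 1 ≤ (a i : ℕ)) ∧ (List.ofFn fun i => sT ((a i : ℕ))).prod = w),
      ∏ i, ((a i : ℕ) : ℚ) = wordSum (Finset.Ioo 0 n) l w := by
  induction l generalizing w with
  | zero =>
    by_cases h : w = 1
    · simp [wordSum, h]
    · simp [wordSum, h, Ne.symm h]
  | succ l ih =>
    rw [wordSum, Finset.sum_filter, ← (Fin.consEquiv fun _ => Fin n).sum_comp,
      Fintype.sum_prod_type]
    have key : ∀ x : Fin n, ∑ y : Fin l → Fin n,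
        (if (∀ i, 1 ≤ (((Fin.consEquiv fun _ => Fin n) (x, y)) i : ℕ)) ∧
            (List.ofFn fun i => sT (((Fin.consEquiv fun _ => Fin n) (x, y)) i : ℕ)).prod = w
          then ∏ i, ((((Fin.consEquiv fun _ => Fin n) (x, y)) i : ℕ) : ℚ) else 0) =
        if 1 ≤ (x : ℕ) then (x : ℚ) * wordSum (Finset.Ioo 0 n) l (sT x * w) else 0 := by
      intro x
      split_ifs with hx
      · rw [← ih, Finset.sum_filter, Finset.mul_sum]
        refine Finset.sum_congr rfl fun y _ => ?_
        have e : sT x * (List.ofFn fun i => sT (y i : ℕ)).prod = w ↔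
            (List.ofFn fun i => sT (y i : ℕ)).prod = sT x * w := by
          constructor
          · rintro rfl; rw [← mul_assoc, sT_mul_self, one_mul]
          · intro h; rw [h, ← mul_assoc, sT_mul_self, one_mul]
        simp [Fin.consEquiv, Fin.forall_fin_succ, List.ofFn_succ, Fin.prod_univ_succ, hx, e]
      · refine Finset.sum_eq_zero fun y _ => if_neg fun h => hx ?_
        simpa [Fin.consEquiv] using h.1 0
    rw [Finset.sum_congr rfl fun x _ => key x,
      Fin.sum_univ_eq_sum_range (fun x => if 1 ≤ x then
        (x : ℚ) * wordSum (Finset.Ioo 0 n) l (sT x * w) else 0) n, ← Finset.sum_filter]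
    refine Finset.sum_congr ?_ fun _ _ => rfl
    ext x
    simp only [Finset.mem_filter, Finset.mem_range, Finset.mem_Ioo]
    omega

theorem Upsilon_eq_wordSum (n : ℕ) (w : Equiv.Perm ℕ) :
    Upsilon n w = ((len n w).factorial : ℚ)⁻¹ * wordSum (Finset.Ioo 0 n) (len n w) w := by
  rw [Upsilon, sum_words_eq_wordSum]

theorem sT_mul_mem_SymmOn {k i : ℕ} {w : Equiv.Perm ℕ} (hw : w ∈ SymmOn k)
    (hi : i ∈ Finset.Ioo 0 k) : sT i * w ∈ SymmOn k := by
  intro x hx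
  rw [Finset.mem_Ioo] at hi
  rw [Equiv.Perm.mul_apply, hw x hx]
  exact sT_apply_of_ne (by omega) (by omega)

theorem sT_comm_of_mem_SymmOn {k i : ℕ} {w : Equiv.Perm ℕ} (hw : w ∈ SymmOn k) (hi : k < i) :
    sT i * w = w * sT i := by
  have h := Equiv.swap_mul_eq_mul_swap w (i) (i + 1)
  have hinv : ∀ x, k < x → w⁻¹ x = x := fun x hx => by
    rw [Equiv.Perm.inv_eq_iff_eq, hw x (Or.inr hx)]
  rwa [hinv i hi, hinv (i + 1) (by omega)] at h

/-- Words of `w ∈ Sₖ` and words in letters greater than `k` can be shuffled. -/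
theorem choose_mul_wordSum_le (k n p q : ℕ) (hkn : k ≤ n) {w : Equiv.Perm ℕ} (hw : w ∈ SymmOn k)
    (v : Equiv.Perm ℕ) :
    ((p + q).choose p : ℚ) * (wordSum (Finset.Ioo 0 k) p w * wordSum (Finset.Ioo k n) q v) ≤
      wordSum (Finset.Ioo 0 n) (p + q) (w * v) := by
  have hsplit : ∀ g : ℕ → ℚ, (∀ i, 0 ≤ g i) →
      ∑ i ∈ Finset.Ioo 0 k, g i + ∑ i ∈ Finset.Ioo k n, g i ≤ ∑ i ∈ Finset.Ioo 0 n, g i := by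
    intro g hg
    rw [← Finset.sum_union]
    · refine Finset.sum_le_sum_of_subset_of_nonneg ?_ fun i _ _ => hg i
      intro i
      simp only [Finset.mem_union, Finset.mem_Ioo]
      omega
    · rw [Finset.disjoint_left]
      intro i
      simp only [Finset.mem_Ioo]
      omega
  obtain ⟨N, hN⟩ : ∃ N, N = p + q := ⟨_, rfl⟩
  induction N generalizing p q w v with
  | zero =>
    obtain ⟨rfl, rfl⟩ : p = 0 ∧ q = 0 := by omega
    simp only [wordSum, Nat.choose_self, Nat.cast_one, one_mul, add_zero]
    by_cases h1 : w = 1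
    · by_cases h2 : v = 1
      · simp [h1, h2]
      · simp [h1, h2]
    · simp only [h1, if_false, zero_mul]; split_ifs <;> norm_num
  | succ N ih =>
    have hp : p ≠ 0 → ((N.choose (p - 1) : ℕ) : ℚ) *
        (wordSum (Finset.Ioo 0 k) p w * wordSum (Finset.Ioo k n) q v) ≤
        ∑ i ∈ Finset.Ioo 0 k, (i : ℚ) * wordSum (Finset.Ioo 0 n) N (sT i * (w * v)) := by
      intro hp0
      obtain ⟨p, rfl⟩ := Nat.exists_eq_succ_of_ne_zero hp0
      rw [Nat.succ_eq_add_one] at hN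
      have hN' : N = p + q := by omega
      rw [wordSum, Finset.sum_mul, Finset.mul_sum]
      refine Finset.sum_le_sum fun i hi => ?_
      have := ih p q (sT_mul_mem_SymmOn hw hi) v hN'
      rw [← hN', mul_assoc] at this
      calc _ = (i : ℚ) * ((N.choose p : ℚ) * (wordSum (Finset.Ioo 0 k) p (sT i * w) *
            wordSum (Finset.Ioo k n) q v)) := by simp; ring
        _ ≤ _ := mul_le_mul_of_nonneg_left this (Nat.cast_nonneg _)
    have hq : q ≠ 0 → ((N.choose p : ℕ) : ℚ) *
        (wordSum (Finset.Ioo 0 k) p w * wordSum (Finset.Ioo k n) q v) ≤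
        ∑ i ∈ Finset.Ioo k n, (i : ℚ) * wordSum (Finset.Ioo 0 n) N (sT i * (w * v)) := by
      intro hq0
      obtain ⟨q, rfl⟩ := Nat.exists_eq_succ_of_ne_zero hq0
      rw [Nat.succ_eq_add_one] at hN
      have hN' : N = p + q := by omega
      rw [wordSum, Finset.mul_sum, Finset.mul_sum]
      refine Finset.sum_le_sum fun i hi => ?_
      have := ih p q hw (sT i * v) hN'
      rw [← hN', ← mul_assoc w, ← sT_comm_of_mem_SymmOn hw (Finset.mem_Ioo.1 hi).1,
        mul_assoc] at this
      calc _ = (i : ℚ) * ((N.choose p : ℚ) * (wordSum (Finset.Ioo 0 k) p w *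
            wordSum (Finset.Ioo k n) q (sT i * v))) := by ring
        _ ≤ _ := mul_le_mul_of_nonneg_left this (Nat.cast_nonneg _)
    have hnn := fun i : ℕ => mul_nonneg (Nat.cast_nonneg (α := ℚ) i)
      (wordSum_nonneg (Finset.Ioo 0 n) N (sT i * (w * v)))
    rw [← hN, wordSum]
    refine le_trans ?_ (hsplit _ hnn)
    rcases Nat.eq_zero_or_pos p with rfl | hp0
    · have h := hq (by omega)
      simp only [Nat.choose_zero_right] at h ⊢
      exact h.trans (le_add_of_nonneg_left (Finset.sum_nonneg fun i _ => hnn i))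
    · rcases Nat.eq_zero_or_pos q with rfl | hq0
      · have h := hp (by omega)
        have e : p = N + 1 := by omega
        subst e
        simp only [Nat.choose_self, Nat.add_sub_cancel] at h ⊢
        exact h.trans (le_add_of_nonneg_right (Finset.sum_nonneg fun i _ => hnn i))
      · obtain ⟨p, rfl⟩ := Nat.exists_eq_succ_of_ne_zero hp0.ne'
        rw [Nat.succ_eq_add_one, Nat.choose_succ_succ, Nat.cast_add, add_mul]
        exact add_le_add (hp (by omega)) (hq (by omega))

/-- The pairs `p < q` of elements of `{k+1, …, n}`. -/
def pairs (k n : ℕ) : Finset (ℕ × ℕ) :=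
  (Finset.Ioc k n ×ˢ Finset.Ioc k n).filter fun p => p.1 < p.2

theorem mem_pairs {k n : ℕ} {p : ℕ × ℕ} : p ∈ pairs k n ↔ k < p.1 ∧ p.1 < p.2 ∧ p.2 ≤ n := by
  simp only [pairs, Finset.mem_filter, Finset.mem_product, Finset.mem_Ioc]
  omega

@[to_additive]
theorem prod_pairs_eq_prod_fst {M : Type*} [CommMonoid M] (k n : ℕ) (F : ℕ → ℕ → M) :
    ∏ p ∈ pairs k n, F p.1 p.2 = ∏ i ∈ Finset.Ioc k n, ∏ j ∈ Finset.Ioc i n, F i j := by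
  rw [Finset.prod_sigma']
  refine Finset.prod_bij' (fun p _ => ⟨p.1, p.2⟩) (fun p _ => (p.1, p.2)) ?_ ?_ ?_ ?_ ?_ <;>
    simp [mem_pairs] <;> omega

@[to_additive]
theorem prod_pairs_eq_prod_snd {M : Type*} [CommMonoid M] (k n : ℕ) (F : ℕ → ℕ → M) :
    ∏ p ∈ pairs k n, F p.1 p.2 = ∏ j ∈ Finset.Ioc k n, ∏ i ∈ Finset.Ioo k j, F i j := by
  rw [Finset.prod_sigma']
  refine Finset.prod_bij' (fun p _ => ⟨p.2, p.1⟩) (fun p _ => (p.2, p.1)) ?_ ?_ ?_ ?_ ?_ <;>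
    simp [mem_pairs] <;> omega

theorem card_pairs (k n : ℕ) : (pairs k n).card = ∑ i ∈ Finset.Ioc k n, (n - i) := by
  rw [Finset.card_eq_sum_ones, sum_pairs_eq_sum_fst k n fun _ _ => 1]
  simp

theorem card_pairs_add (k n : ℕ) :
    (pairs k n).card + k * (n - k) = ∑ i ∈ Finset.Ioc k n, (i - 1) := by
  rw [Finset.card_eq_sum_ones, sum_pairs_eq_sum_snd k n fun _ _ => 1]
  have : k * (n - k) = ∑ i ∈ Finset.Ioc k n, k := by simp [mul_comm]
  rw [this, ← Finset.sum_add_distrib]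
  refine Finset.sum_congr rfl fun i hi => ?_
  rw [Finset.mem_Ioc] at hi
  simp only [Finset.sum_const, Nat.card_Ioo, smul_eq_mul, mul_one]
  omega

theorem sT_apply (i x : ℕ) : sT i x = if x = i then i + 1 else if x = i + 1 then i else x :=
  Equiv.swap_apply_def _ _ _

theorem sT_sT (i x : ℕ) : sT i (sT i x) = x := by
  rw [← Equiv.Perm.mul_apply, sT_mul_self, Equiv.Perm.one_apply]

@[to_additive]
theorem prod_pairs_sT {M : Type*} [CommMonoid M] {k n i : ℕ} (hi : i ∈ Finset.Ioo k n)
    (F : ℕ → ℕ → M) :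
    (∏ p ∈ pairs k n, F (sT i p.1) (sT i p.2)) * F i (i + 1) =
      (∏ p ∈ pairs k n, F p.1 p.2) * F (i + 1) i := by
  rw [Finset.mem_Ioo] at hi
  have hmem : (i, i + 1) ∈ pairs k n := by rw [mem_pairs]; dsimp only; omega
  rw [← Finset.mul_prod_erase _ _ hmem, ← Finset.mul_prod_erase (pairs k n)
    (fun p => F p.1 p.2) hmem]
  have h : ∏ p ∈ (pairs k n).erase (i, i + 1), F (sT i p.1) (sT i p.2) =
      ∏ p ∈ (pairs k n).erase (i, i + 1), F p.1 p.2 := by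
    refine Finset.prod_nbij' (fun p => (sT i p.1, sT i p.2)) (fun p => (sT i p.1, sT i p.2))
      ?_ ?_ ?_ ?_ ?_
    iterate 2
      rintro ⟨p, q⟩
      simp only [Finset.mem_erase, mem_pairs, sT_apply, ne_eq, Prod.mk.injEq]
      split_ifs <;> omega
    iterate 2
      rintro ⟨p, q⟩ _
      simp only [sT_sT]
    · intros; rfl
  rw [h]
  have h1 : sT i i = i + 1 := by simp [sT_apply]
  have h2 : sT i (i + 1) = i := by simp [sT_apply]
  simp only [h1, h2]
  rw [mul_assoc, mul_comm, mul_right_comm]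
  ac_rfl

/-- The permutation reversing the interval `{k+1, …, n}`. -/
def blockRev (k n : ℕ) : Equiv.Perm ℕ :=
  Function.Involutive.toPerm (fun x => if k < x ∧ x ≤ n then n + k + 1 - x else x) fun x => by
    dsimp only
    split_ifs <;> omega

theorem blockRev_apply (k n x : ℕ) :
    blockRev k n x = if k < x ∧ x ≤ n then n + k + 1 - x else x := rfl

theorem mul_blockRev_mem_SymmOn {k n : ℕ} (hkn : k ≤ n) {w : Equiv.Perm ℕ} (hw : w ∈ SymmOn k) :
    w * blockRev k n ∈ SymmOn n := by
  intro x hx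
  rw [Equiv.Perm.mul_apply, blockRev_apply, if_neg (by omega)]
  exact hw x (by omega)

theorem len_mul_blockRev {k n : ℕ} (hkn : k ≤ n) {w : Equiv.Perm ℕ} (hw : w ∈ SymmOn k) :
    len n (w * blockRev k n) = len k w + (pairs k n).card := by
  have hfix : ∀ x, k < x → w x = x := fun x hx => hw x (Or.inr hx)
  have hle : ∀ x, x ≤ k → w x ≤ k := fun x hx => by
    by_contra h
    have := w.injective (hfix (w x) (by omega))
    omega
  rw [len, len, ← Finset.card_union_of_disjoint]
  · congr 1
    ext ⟨p, q⟩
    simp only [Finset.mem_union, Finset.mem_filter, Finset.mem_product, Finset.mem_Icc, mem_pairs]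
    simp only [Equiv.Perm.mul_apply, blockRev_apply]
    by_cases hq : q ≤ k
    · by_cases hp : p ≤ k
      · rw [if_neg (by omega), if_neg (by omega)]
        omega
      · omega
    · by_cases hp : p ≤ k
      · rw [if_neg (by omega : ¬(k < p ∧ p ≤ n))]
        have := hle p hp
        by_cases hqn : q ≤ n
        · rw [if_pos (by omega), hfix (n + k + 1 - q) (by omega)]
          omega
        · omega
      · by_cases hqn : q ≤ n
        · by_cases hpq : p < q
          · rw [if_pos (by omega), if_pos (by omega), hfix _ (by omega), hfix _ (by omega)]
            omega
          · omega
        · omega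
  · rw [Finset.disjoint_left]
    rintro ⟨p, q⟩
    simp only [Finset.mem_filter, Finset.mem_product, Finset.mem_Icc, mem_pairs]
    omega

theorem Upsilon_mul_le {k n : ℕ} (hkn : k ≤ n) {w : Equiv.Perm ℕ} (hw : w ∈ SymmOn k) {c : ℚ}
    (hc : ((pairs k n).card.factorial : ℚ) * c ≤
      wordSum (Finset.Ioo k n) (pairs k n).card (blockRev k n)) :
    Upsilon k w * c ≤ Upsilon n (w * blockRev k n) := by
  rw [Upsilon_eq_wordSum, Upsilon_eq_wordSum, len_mul_blockRev hkn hw]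
  set p := len k w
  set q := (pairs k n).card
  have h := choose_mul_wordSum_le k n p q hkn hw (blockRev k n)
  rw [le_inv_mul_iff₀ (by positivity)]
  refine le_trans ?_ h
  have e : ((p + q).factorial : ℚ) = ((p + q).choose p : ℚ) * p.factorial * q.factorial := by
    have := Nat.add_choose_mul_factorial_mul_factorial p q
    rw [← Nat.choose_symm_add] at this
    exact_mod_cast this.symm
  have hp : (p.factorial : ℚ) ≠ 0 := by positivity
  calc _ = ((p + q).choose p : ℚ) * (wordSum (Finset.Ioo 0 k) p w * (q.factorial * c)) := by
        rw [e]; field_simp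
    _ ≤ _ := by
        refine mul_le_mul_of_nonneg_left (mul_le_mul_of_nonneg_left hc (wordSum_nonneg _ _ _))
          (Nat.cast_nonneg _)

/-- The product of `v q - v p` over the non-inversions `p < q` of `v` in `{k+1, …, n}`. -/
def ascProd (k n : ℕ) (v : Equiv.Perm ℕ) : ℚ :=
  ∏ p ∈ pairs k n, if v p.1 < v p.2 then (v p.2 : ℚ) - v p.1 else 1

/-- The number of inversions of `v` in `{k+1, …, n}`. -/
def invCount (k n : ℕ) (v : Equiv.Perm ℕ) : ℕ :=
  ∑ p ∈ pairs k n, if v p.2 < v p.1 then 1 else 0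

theorem ascProd_pos (k n : ℕ) (v : Equiv.Perm ℕ) : 0 < ascProd k n v := by
  refine Finset.prod_pos fun p _ => ?_
  split_ifs with h
  · exact sub_pos.2 (by exact_mod_cast h)
  · exact one_pos

theorem ascProd_of_lt {k n i : ℕ} (hi : i ∈ Finset.Ioo k n) {v : Equiv.Perm ℕ}
    (h : v i < v (i + 1)) :
    ascProd k n v = ascProd k n (v * sT i) * ((v (i + 1) : ℚ) - v i) := by
  have := prod_pairs_sT hi fun a b => if v a < v b then (v b : ℚ) - v a else 1
  rw [if_pos h, if_neg h.not_gt, mul_one] at this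
  exact this.symm

theorem invCount_of_lt {k n i : ℕ} (hi : i ∈ Finset.Ioo k n) {v : Equiv.Perm ℕ}
    (h : v i < v (i + 1)) : invCount k n (v * sT i) = invCount k n v + 1 := by
  have := sum_pairs_sT hi fun a b => if v b < v a then 1 else 0
  rw [if_pos h, if_neg h.not_gt, add_zero] at this
  exact this

theorem invCount_of_gt {k n i : ℕ} (hi : i ∈ Finset.Ioo k n) {v : Equiv.Perm ℕ}
    (h : v (i + 1) < v i) : invCount k n (v * sT i) + 1 = invCount k n v := by
  have := sum_pairs_sT hi fun a b => if v b < v a then 1 else 0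
  rw [if_pos h, if_neg h.not_gt, add_zero] at this
  exact this

theorem invCount_one (k n : ℕ) : invCount k n 1 = 0 :=
  Finset.sum_eq_zero fun _ hp => if_neg (mem_pairs.1 hp).2.1.not_gt

theorem blockRev_lt_of_mem_pairs {k n : ℕ} {p : ℕ × ℕ} (hp : p ∈ pairs k n) :
    blockRev k n p.2 < blockRev k n p.1 := by
  rw [mem_pairs] at hp
  rw [blockRev_apply, blockRev_apply, if_pos (by omega), if_pos (by omega)]
  omega

theorem invCount_blockRev (k n : ℕ) : invCount k n (blockRev k n) = (pairs k n).card := by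
  rw [invCount, Finset.sum_congr rfl fun p hp => if_pos (blockRev_lt_of_mem_pairs hp)]
  simp

theorem ascProd_blockRev (k n : ℕ) : ascProd k n (blockRev k n) = 1 :=
  Finset.prod_eq_one fun _ hp => if_neg (blockRev_lt_of_mem_pairs hp).not_gt

/-- A comparison principle for iterated divided differences along the orbit of a point: the values
at the identity are controlled by words of the longest permutation. -/
theorem dividedDifference_iterate_le (k n : ℕ) (A : ℕ → Equiv.Perm ℕ → ℚ)
    (hzero : ∀ v : Equiv.Perm ℕ, (∀ x ∉ Finset.Ioc k n, v x = x) → v ≠ blockRev k n → A 0 v = 0)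
    (hrev : A 0 (blockRev k n) = ascProd k n 1)
    (hsucc : ∀ l v, A (l + 1) v = ∑ i ∈ Finset.Ioo k n,
      (i : ℚ) * ((A l v - A l (v * sT i)) / ((v i : ℚ) - v (i + 1)))) :
    A (pairs k n).card 1 ≤ wordSum (Finset.Ioo k n) (pairs k n).card (blockRev k n) := by
  have key : ∀ l (v : Equiv.Perm ℕ), (∀ x ∉ Finset.Ioc k n, v x = x) →
      (l + invCount k n v < (pairs k n).card → A l v = 0) ∧
      (l + invCount k n v = (pairs k n).card → A l v * ascProd k n v ≤
        ascProd k n 1 * wordSum (Finset.Ioo k n) l (v⁻¹ * blockRev k n)) := by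
    intro l
    induction l with
    | zero =>
      intro v hv
      constructor
      · intro h
        refine hzero v hv ?_
        rintro rfl
        rw [invCount_blockRev] at h
        omega
      · intro _
        by_cases h : v = blockRev k n
        · rw [h, hrev, ascProd_blockRev, inv_mul_cancel]
          simp [wordSum]
        · rw [hzero v hv h, zero_mul]
          exact mul_nonneg (ascProd_pos _ _ _).le (wordSum_nonneg _ _ _)
    | succ l ih =>
      intro v hv
      have hvs : ∀ i ∈ Finset.Ioo k n, ∀ x ∉ Finset.Ioc k n, (v * sT i) x = x := by
        intro i hi x hx
        rw [Finset.mem_Ioo] at hi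
        have hx' := hx
        rw [Finset.mem_Ioc] at hx'
        rw [Equiv.Perm.mul_apply, sT_apply_of_ne (by omega) (by omega), hv x hx]
      have hlt : ∀ i, v i < v (i + 1) ∨ v (i + 1) < v i := fun i =>
        lt_or_gt_of_ne fun h => by have := v.injective h; omega
      constructor
      · intro h
        rw [hsucc]
        refine Finset.sum_eq_zero fun i hi => ?_
        rw [(ih v hv).1 (by omega), (ih _ (hvs i hi)).1 ?_]
        · simp
        · rcases hlt i with h' | h'
          · rw [invCount_of_lt hi h']; omega
          · have := invCount_of_gt hi h'; omega
      · intro h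
        rw [hsucc, wordSum, Finset.sum_mul, Finset.mul_sum]
        refine Finset.sum_le_sum fun i hi => ?_
        rw [(ih v hv).1 (by omega), mul_left_comm, mul_assoc]
        refine mul_le_mul_of_nonneg_left ?_ (Nat.cast_nonneg _)
        rcases hlt i with h' | h'
        · have h1 := (ih _ (hvs i hi)).2 (by rw [invCount_of_lt hi h']; omega)
          have e : (v * sT i)⁻¹ * blockRev k n = sT i * (v⁻¹ * blockRev k n) := by
            rw [mul_inv_rev, inv_eq_of_mul_eq_one_right (sT_mul_self i), mul_assoc]
          rw [e] at h1
          refine le_of_eq_of_le ?_ h1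
          rw [ascProd_of_lt hi h']
          have : (v i : ℚ) - v (i + 1) ≠ 0 := by
            rw [sub_ne_zero]; exact_mod_cast h'.ne
          field_simp
          ring
        · rw [(ih _ (hvs i hi)).1 (by have := invCount_of_gt hi h'; omega)]
          simpa using mul_nonneg (ascProd_pos k n 1).le (wordSum_nonneg _ _ _)
  have h := (key (pairs k n).card 1 fun _ _ => rfl).2 (by rw [invCount_one, add_zero])
  rw [inv_one, one_mul, mul_comm] at h
  exact le_of_mul_le_mul_left h (ascProd_pos _ _ _)

open MvPolynomial in
theorem exists_mul_eq_sub_rename_sT (i : ℕ) (P : MvPolynomial ℕ ℚ) :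
    ∃ Q, (X i - X (i + 1)) * Q = P - rename (sT i) P := by
  induction P using MvPolynomial.induction_on with
  | C a => exact ⟨0, by simp⟩
  | add p q hp hq =>
    obtain ⟨a, ha⟩ := hp
    obtain ⟨b, hb⟩ := hq
    exact ⟨a + b, by rw [mul_add, ha, hb, map_add]; ring⟩
  | mul_X p j hp =>
    obtain ⟨a, ha⟩ := hp
    have hj : ∃ b : MvPolynomial ℕ ℚ, (X i - X (i + 1)) * b = X j - X (sT i j) := by
      rw [sT_apply]
      split_ifs with h h'
      · exact ⟨1, by rw [h, mul_one]⟩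
      · exact ⟨-1, by rw [h']; ring⟩
      · exact ⟨0, by ring⟩
    obtain ⟨b, hb⟩ := hj
    refine ⟨a * X j + rename (sT i) p * b, ?_⟩
    rw [map_mul, rename_X]
    linear_combination X j * ha + rename (sT i) p * hb

open MvPolynomial in
theorem X_sub_X_succ_ne_zero (i : ℕ) : (X i - X (i + 1) : MvPolynomial ℕ ℚ) ≠ 0 :=
  sub_ne_zero.2 fun h => by simpa using X_injective h

open MvPolynomial in
/-- The divided difference operator `∂ᵢ P = (P - sᵢ P) / (Xᵢ - Xᵢ₊₁)`. -/
noncomputable def divDiff (i : ℕ) : Module.End ℚ (MvPolynomial ℕ ℚ) where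
  toFun P := (exists_mul_eq_sub_rename_sT i P).choose
  map_add' P Q := by
    refine mul_left_cancel₀ (X_sub_X_succ_ne_zero i) ?_
    rw [mul_add, (exists_mul_eq_sub_rename_sT i (P + Q)).choose_spec,
      (exists_mul_eq_sub_rename_sT i P).choose_spec,
      (exists_mul_eq_sub_rename_sT i Q).choose_spec, map_add]
    ring
  map_smul' c P := by
    refine mul_left_cancel₀ (X_sub_X_succ_ne_zero i) ?_
    rw [RingHom.id_apply, mul_smul_comm, (exists_mul_eq_sub_rename_sT i (c • P)).choose_spec,
      (exists_mul_eq_sub_rename_sT i P).choose_spec, map_smul, smul_sub]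

open MvPolynomial in
theorem mul_divDiff (i : ℕ) (P : MvPolynomial ℕ ℚ) :
    (X i - X (i + 1)) * divDiff i P = P - rename (sT i) P :=
  (exists_mul_eq_sub_rename_sT i P).choose_spec

open MvPolynomial in
theorem rename_sT_rename_sT (i : ℕ) (P : MvPolynomial ℕ ℚ) :
    rename (sT i) (rename (sT i) P) = P := by
  rw [rename_rename]
  have : (sT i : ℕ → ℕ) ∘ sT i = id := funext (sT_sT i)
  rw [this, rename_id_apply]

theorem sT_self (i : ℕ) : sT i i = i + 1 := by simp [sT_apply]

theorem sT_succ (i : ℕ) : sT i (i + 1) = i := by simp [sT_apply]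

open MvPolynomial in
theorem rename_divDiff (i : ℕ) (P : MvPolynomial ℕ ℚ) :
    rename (sT i) (divDiff i P) = divDiff i P := by
  refine mul_left_cancel₀ (X_sub_X_succ_ne_zero i) ?_
  have h := congrArg (rename (sT i)) (mul_divDiff i P)
  rw [map_mul, map_sub, map_sub, rename_X, rename_X, sT_self, sT_succ, rename_sT_rename_sT] at h
  rw [mul_divDiff]
  linear_combination -h

open MvPolynomial in
theorem coeff_mul_divDiff {i : ℕ} {T : MvPolynomial ℕ ℚ} (hT : rename (sT i) T = -T) {B : ℕ →₀ ℕ}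
    (hB : B (i + 1) = B i + 1) (P : MvPolynomial ℕ ℚ) :
    coeff B (T * divDiff i P) = coeff (B + Finsupp.single i 1) (T * P) := by
  set Z := T * divDiff i P with hZ
  have hZs : rename (sT i) Z = -Z := by rw [hZ, map_mul, hT, rename_divDiff, neg_mul]
  have hQ : (X i - X (i + 1)) * Z = T * P + rename (sT i) (T * P) := by
    rw [map_mul, hT]
    linear_combination T * mul_divDiff i P
  have hB' : B + Finsupp.single i 1 = Finsupp.mapDomain (sT i) B + Finsupp.single (i + 1) 1 := by
    ext x
    rw [Finsupp.add_apply, Finsupp.add_apply, Finsupp.mapDomain_equiv_apply,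
      show (sT i).symm x = sT i x from rfl, sT_apply, Finsupp.single_apply, Finsupp.single_apply]
    split_ifs <;> subst_vars <;> omega
  have hB'' : Finsupp.mapDomain (sT i) (B + Finsupp.single i 1) = B + Finsupp.single i 1 := by
    ext x
    rw [Finsupp.mapDomain_equiv_apply, show (sT i).symm x = sT i x from rfl, sT_apply,
      Finsupp.add_apply, Finsupp.add_apply, Finsupp.single_apply, Finsupp.single_apply]
    split_ifs <;> subst_vars <;> omega
  have h1 : coeff (B + Finsupp.single i 1) ((X i - X (i + 1)) * Z) = 2 * coeff B Z := by
    rw [sub_mul, coeff_sub, mul_comm, coeff_mul_X, hB', mul_comm, coeff_mul_X]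
    have := coeff_rename_mapDomain (sT i) (sT i).injective Z B
    rw [hZs, coeff_neg] at this
    linarith
  have h2 : coeff (B + Finsupp.single i 1) (rename (sT i) (T * P)) =
      coeff (B + Finsupp.single i 1) (T * P) := by
    conv_lhs => rw [← hB'']
    exact coeff_rename_mapDomain (sT i) (sT i).injective _ _
  rw [hQ, coeff_add, h2] at h1
  linarith

open MvPolynomial in
/-- The Euler derivation in the shifted variables `Xᵢ + 1` for `i ∈ I`. -/
noncomputable def shiftedEuler (I : Finset ℕ) :
    Derivation ℚ (MvPolynomial ℕ ℚ) (MvPolynomial ℕ ℚ) :=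
  ∑ i ∈ I, (X i + 1 : MvPolynomial ℕ ℚ) • pderiv i

open MvPolynomial in
theorem shiftedEuler_apply (I : Finset ℕ) (P : MvPolynomial ℕ ℚ) :
    shiftedEuler I P = ∑ i ∈ I, (X i + 1) * pderiv i P := by
  have h := congrFun (map_sum (Derivation.coeFnAddMonoidHom (R := ℚ) (A := MvPolynomial ℕ ℚ)
    (M := MvPolynomial ℕ ℚ)) (fun i => (X i + 1 : MvPolynomial ℕ ℚ) • pderiv i) I) P
  rw [Finset.sum_apply] at h
  exact h

open MvPolynomial in
theorem shiftedEuler_X (I : Finset ℕ) (j : ℕ) :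
    shiftedEuler I (X j) = if j ∈ I then X j + 1 else 0 := by
  simp [shiftedEuler_apply, pderiv_X, Pi.single_apply, Finset.sum_ite_eq]

open MvPolynomial in
theorem coeff_shiftedEuler (I : Finset ℕ) (P : MvPolynomial ℕ ℚ) (m : ℕ →₀ ℕ) :
    coeff m (shiftedEuler I P) =
      ∑ i ∈ I, ((m i : ℚ) * coeff m P + (m i + 1) * coeff (m + Finsupp.single i 1) P) := by
  rw [shiftedEuler_apply, coeff_sum]
  refine Finset.sum_congr rfl fun i _ => ?_
  rw [add_mul, one_mul, coeff_add, coeff_pderiv, coeff_X_mul']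
  split_ifs with h
  · rw [coeff_pderiv]
    have h1 : 1 ≤ m i := Nat.one_le_iff_ne_zero.2 (Finsupp.mem_support_iff.1 h)
    have h2 : m - Finsupp.single i 1 + Finsupp.single i 1 = m :=
      tsub_add_cancel_of_le (Finsupp.single_le_iff.2 h1)
    rw [h2, Finsupp.tsub_apply, Finsupp.single_eq_same]
    push_cast [h1]
    ring
  · rw [Finsupp.notMem_support_iff.1 h]
    push_cast
    ring

theorem sT_mem_Ioc {k n i : ℕ} (hi : i ∈ Finset.Ioo k n) (j : ℕ) :
    sT i j ∈ Finset.Ioc k n ↔ j ∈ Finset.Ioc k n := by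
  rw [Finset.mem_Ioo] at hi
  rw [sT_apply, Finset.mem_Ioc, Finset.mem_Ioc]
  split_ifs <;> omega

open MvPolynomial in
theorem shiftedEuler_rename {k n i : ℕ} (hi : i ∈ Finset.Ioo k n) (P : MvPolynomial ℕ ℚ) :
    shiftedEuler (Finset.Ioc k n) (rename (sT i) P) =
      rename (sT i) (shiftedEuler (Finset.Ioc k n) P) := by
  induction P using MvPolynomial.induction_on with
  | C a => simp
  | add p q hp hq => simp only [map_add, hp, hq]
  | mul_X p j hp =>
    rw [map_mul, Derivation.leibniz, hp, rename_X, shiftedEuler_X, Derivation.leibniz,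
      shiftedEuler_X]
    simp only [sT_mem_Ioc hi, smul_eq_mul, map_add, map_mul, rename_X]
    split_ifs <;> simp

open MvPolynomial in
theorem shiftedEuler_divDiff {k n i : ℕ} (hi : i ∈ Finset.Ioo k n) (P : MvPolynomial ℕ ℚ) :
    shiftedEuler (Finset.Ioc k n) (divDiff i P) =
      divDiff i (shiftedEuler (Finset.Ioc k n) P - P) := by
  have h := congrArg (shiftedEuler (Finset.Ioc k n)) (mul_divDiff i P)
  have hi' := Finset.mem_Ioo.1 hi
  rw [Derivation.leibniz, map_sub, map_sub, shiftedEuler_rename hi, ← mul_divDiff,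
    shiftedEuler_X, shiftedEuler_X, if_pos (Finset.mem_Ioc.2 (by omega)),
    if_pos (Finset.mem_Ioc.2 (by omega)), smul_eq_mul, smul_eq_mul] at h
  refine mul_left_cancel₀ (X_sub_X_succ_ne_zero i) ?_
  rw [map_sub]
  linear_combination h

open MvPolynomial in
/-- Polynomials whose degree in `Xᵢ` is at most `n - i` for every `i ∈ {k+1, …, n}`. -/
noncomputable def staircase (k n : ℕ) : Submodule ℚ (MvPolynomial ℕ ℚ) :=
  restrictSupport ℚ {m | ∀ i ∈ Finset.Ioc k n, m i ≤ n - i}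

open MvPolynomial in
theorem mem_staircase {k n : ℕ} {P : MvPolynomial ℕ ℚ} :
    P ∈ staircase k n ↔ ∀ i ∈ Finset.Ioc k n, degreeOf i P ≤ n - i := by
  rw [staircase, mem_restrictSupport_iff]
  simp only [degreeOf_le_iff]
  exact ⟨fun h i hi m hm => h hm i hi, fun h m hm i hi => h i hi m hm⟩

open MvPolynomial in
theorem degreeOf_X_sub_X_succ (i j : ℕ) (hj : j = i ∨ j = i + 1) :
    1 ≤ degreeOf j (X i - X (i + 1) : MvPolynomial ℕ ℚ) := by
  have h : Finsupp.single j 1 ∈ (X i - X (i + 1) : MvPolynomial ℕ ℚ).support := by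
    rw [mem_support_iff, coeff_sub, coeff_X, coeff_X]
    rcases hj with rfl | rfl
    · simp [Finsupp.single_left_inj]
    · simp [Finsupp.single_left_inj]
  simpa using monomial_le_degreeOf j h

open MvPolynomial in
theorem degreeOf_add_degreeOf_divDiff_le (i j : ℕ) {P : MvPolynomial ℕ ℚ} (h : divDiff i P ≠ 0) :
    degreeOf j (X i - X (i + 1) : MvPolynomial ℕ ℚ) + degreeOf j (divDiff i P) ≤
      max (degreeOf j P) (degreeOf (sT i j) P) := by
  rw [← degreeOf_mul_eq (X_sub_X_succ_ne_zero i) h, mul_divDiff]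
  refine (degreeOf_sub_le _ _ _).trans (max_le_max le_rfl ?_)
  conv_lhs => rw [← sT_sT i j]
  rw [degreeOf_rename_of_injective (sT i).injective]

open MvPolynomial in
theorem divDiff_mem_staircase {k n i : ℕ} (hi : i ∈ Finset.Ioo k n) {P : MvPolynomial ℕ ℚ}
    (hP : P ∈ staircase k n) : divDiff i P ∈ staircase k n := by
  by_cases h : divDiff i P = 0
  · rw [h]; exact zero_mem _
  rw [mem_staircase] at hP ⊢
  intro j hj
  have h1 := degreeOf_add_degreeOf_divDiff_le i j h
  have h2 := hP _ ((sT_mem_Ioc hi j).2 hj)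
  have h3 := hP _ hj
  have h4 := degreeOf_X_sub_X_succ i j
  rw [Finset.mem_Ioo] at hi
  rw [Finset.mem_Ioc] at hj
  have h5 : sT i j = if j = i then i + 1 else if j = i + 1 then i else j := sT_apply i j
  split_ifs at h5 <;> rw [h5] at h1 h2 <;> omega

open MvPolynomial in
theorem shiftedEuler_mem_staircase {k n : ℕ} {I : Finset ℕ} {P : MvPolynomial ℕ ℚ}
    (hP : P ∈ staircase k n) : shiftedEuler I P ∈ staircase k n := by
  rw [mem_staircase] at hP ⊢
  intro i hi
  rw [degreeOf_le_iff]
  intro m hm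
  by_contra hlt
  rw [mem_support_iff, coeff_shiftedEuler] at hm
  refine hm (Finset.sum_eq_zero fun j _ => ?_)
  have h1 : coeff m P = 0 := by
    rw [← notMem_support_iff]
    exact fun h => hlt (degreeOf_le_iff.1 (hP i hi) m h)
  have h2 : coeff (m + Finsupp.single j 1) P = 0 := by
    rw [← notMem_support_iff]
    intro h
    have := degreeOf_le_iff.1 (hP i hi) _ h
    rw [Finsupp.add_apply] at this
    omega
  rw [h1, h2, mul_zero, mul_zero, add_zero]

open MvPolynomial in
theorem totalDegree_divDiff_le (i : ℕ) (P : MvPolynomial ℕ ℚ) :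
    (divDiff i P).totalDegree ≤ P.totalDegree - 1 := by
  by_cases h : divDiff i P = 0
  · rw [h]; simp
  have h1 := totalDegree_mul_of_isDomain (X_sub_X_succ_ne_zero i) h
  rw [mul_divDiff] at h1
  have h2 := (totalDegree_sub P (rename (sT i) P)).trans
    (max_le_max le_rfl (totalDegree_rename_le _ P))
  rw [max_self] at h2
  have h3 := (degreeOf_X_sub_X_succ i i (Or.inl rfl)).trans (degreeOf_le_totalDegree _ _)
  omega

/-- The weighted sum `∑ i ∂ᵢ` of divided differences over `k < i < n`. -/
noncomputable def weightedDivDiff (k n : ℕ) : Module.End ℚ (MvPolynomial ℕ ℚ) :=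
  ∑ i ∈ Finset.Ioo k n, (i : ℚ) • divDiff i

theorem weightedDivDiff_apply (k n : ℕ) (P : MvPolynomial ℕ ℚ) :
    weightedDivDiff k n P = ∑ i ∈ Finset.Ioo k n, (i : ℚ) • divDiff i P := by
  rw [weightedDivDiff, LinearMap.sum_apply]
  rfl

theorem weightedDivDiff_mem_staircase {k n : ℕ} {P : MvPolynomial ℕ ℚ}
    (hP : P ∈ staircase k n) : weightedDivDiff k n P ∈ staircase k n := by
  rw [weightedDivDiff_apply]
  exact Submodule.sum_mem _ fun i hi => Submodule.smul_mem _ _ (divDiff_mem_staircase hi hP)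

open MvPolynomial in
theorem totalDegree_weightedDivDiff_pow_le (k n l : ℕ) (P : MvPolynomial ℕ ℚ) :
    ((weightedDivDiff k n ^ l) P).totalDegree ≤ P.totalDegree - l := by
  induction l with
  | zero => simp
  | succ l ih =>
    rw [pow_succ', Module.End.mul_apply, weightedDivDiff_apply]
    refine (totalDegree_finsetSum _ _).trans (Finset.sup_le fun i _ => ?_)
    refine (totalDegree_smul_le _ _).trans ((totalDegree_divDiff_le _ _).trans ?_)
    omega

theorem shiftedEuler_weightedDivDiff (k n : ℕ) (P : MvPolynomial ℕ ℚ) :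
    shiftedEuler (Finset.Ioc k n) (weightedDivDiff k n P) =
      weightedDivDiff k n (shiftedEuler (Finset.Ioc k n) P - P) := by
  rw [weightedDivDiff_apply, weightedDivDiff_apply, map_sum]
  refine Finset.sum_congr rfl fun i hi => ?_
  rw [Derivation.map_smul, shiftedEuler_divDiff hi]

theorem shiftedEuler_weightedDivDiff_pow (k n l : ℕ) (P : MvPolynomial ℕ ℚ) :
    shiftedEuler (Finset.Ioc k n) ((weightedDivDiff k n ^ l) P) =
      (weightedDivDiff k n ^ l) (shiftedEuler (Finset.Ioc k n) P - (l : ℚ) • P) := by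
  induction l with
  | zero => simp
  | succ l ih =>
    rw [pow_succ', Module.End.mul_apply, shiftedEuler_weightedDivDiff, ih, Module.End.mul_apply,
      ← map_sub]
    congr 2
    push_cast
    rw [add_smul, one_smul, sub_sub]

/-- The falling factorial `E (E - 1) ⋯ (E - l + 1)` of a linear endomorphism. -/
noncomputable def fallingEnd {M : Type*} [AddCommGroup M] [Module ℚ M] (E : Module.End ℚ M) :
    ℕ → Module.End ℚ M
  | 0 => 1
  | l + 1 => fallingEnd E l * (E - (l : ℚ) • 1)

theorem commute_fallingEnd {M : Type*} [AddCommGroup M] [Module ℚ M] (E : Module.End ℚ M)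
    (l : ℕ) : Commute E (fallingEnd E l) := by
  induction l with
  | zero => exact Commute.one_right _
  | succ l ih =>
    exact ih.mul_right ((Commute.refl E).sub_right ((Commute.one_right E).smul_right _))

theorem fallingEnd_succ_apply {M : Type*} [AddCommGroup M] [Module ℚ M] (E : Module.End ℚ M)
    (l : ℕ) (P : M) : fallingEnd E (l + 1) P = fallingEnd E l (E P - (l : ℚ) • P) := rfl

theorem fallingEnd_succ_apply' {M : Type*} [AddCommGroup M] [Module ℚ M] (E : Module.End ℚ M)
    (l : ℕ) (P : M) :
    fallingEnd E (l + 1) P = E (fallingEnd E l P) - (l : ℚ) • fallingEnd E l P := by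
  have h := LinearMap.congr_fun (commute_fallingEnd E l).eq P
  rw [Module.End.mul_apply, Module.End.mul_apply] at h
  rw [fallingEnd_succ_apply, map_sub, map_smul, h]

/-- If `E Y = Y`, then `E + 1` intertwines multiplication by `Y`. -/
theorem fallingEnd_mul {A : Type*} [CommRing A] [Algebra ℚ A] (E : Derivation ℚ A A) {Y : A}
    (hY : E Y = Y) (l : ℕ) (Q : A) :
    fallingEnd (E : Module.End ℚ A) (l + 1) (Y * Q) =
      Y * (fallingEnd (E : Module.End ℚ A) l Q + E (fallingEnd (E : Module.End ℚ A) l Q)) := by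
  induction l generalizing Q with
  | zero =>
    rw [fallingEnd_succ_apply]
    simp [fallingEnd, hY]
    ring
  | succ l ih =>
    have : (E : Module.End ℚ A) (Y * Q) - ((l + 1 : ℕ) : ℚ) • (Y * Q) =
        Y * ((E : Module.End ℚ A) Q - (l : ℚ) • Q) := by
      simp only [Derivation.coeFn_coe, Derivation.leibniz, hY, smul_eq_mul, mul_sub, mul_smul_comm]
      push_cast
      rw [add_smul, one_smul, mul_comm Q Y]
      abel
    rw [fallingEnd_succ_apply, this, ih, ← fallingEnd_succ_apply]

theorem derivation_prod_of_eigenvectors {A ι : Type*} [CommRing A] [Algebra ℚ A]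
    (E : Derivation ℚ A A) (s : Finset ι) (Y : ι → A) (hY : ∀ i ∈ s, E (Y i) = Y i) :
    E (∏ i ∈ s, Y i) = (s.card : ℚ) • ∏ i ∈ s, Y i := by
  classical
  induction s using Finset.induction_on with
  | empty => simp
  | insert a s ha ih =>
    rw [Finset.prod_insert ha, Derivation.leibniz,
      ih fun i hi => hY i (Finset.mem_insert_of_mem hi),
      hY a (Finset.mem_insert_self _ _), Finset.card_insert_of_notMem ha, smul_eq_mul, smul_eq_mul,
      mul_smul_comm]
    push_cast
    rw [add_smul, one_smul, mul_comm (∏ i ∈ s, Y i)]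

theorem fallingEnd_prod_sub {A ι : Type*} [CommRing A] [Algebra ℚ A]
    (E : Derivation ℚ A A) (s : Finset ι) (Y : ι → A) (hY : ∀ i ∈ s, E (Y i) = Y i) (c : ι → ℚ) :
    fallingEnd (E : Module.End ℚ A) s.card (∏ i ∈ s, (Y i - algebraMap ℚ A (c i))) =
      (s.card.factorial : ℚ) • ∏ i ∈ s, Y i := by
  classical
  induction s using Finset.induction_on with
  | empty => simp [fallingEnd]
  | insert a s ha ih =>
    have ih := ih fun i hi => hY i (Finset.mem_insert_of_mem hi)
    have hE := derivation_prod_of_eigenvectors E s Y fun i hi => hY i (Finset.mem_insert_of_mem hi)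
    rw [Finset.prod_insert ha, Finset.prod_insert ha, Finset.card_insert_of_notMem ha, sub_mul,
      ← Algebra.smul_def, map_sub, map_smul, fallingEnd_mul E (hY a (Finset.mem_insert_self _ _)),
      fallingEnd_succ_apply', ih, Derivation.coeFn_coe, Derivation.map_smul, hE,
      Nat.factorial_succ]
    simp only [smul_smul, mul_smul_comm, ← add_smul, ← sub_smul]
    push_cast
    rw [mul_comm (s.card : ℚ) (s.card.factorial : ℚ), sub_self, mul_zero, zero_smul, sub_zero]
    congr 1
    ring

open MvPolynomial in
/-- The antisymmetric weight `∏ (Xᵢ + 1)ᵏ ∏ (X_q - X_p)` in the variables `k < i ≤ n`. -/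
noncomputable def antisymmWeight (k n : ℕ) : MvPolynomial ℕ ℚ :=
  (∏ i ∈ Finset.Ioc k n, (X i + 1) ^ k) * ∏ p ∈ pairs k n, (X p.2 - X p.1)

/-- The exponent with entry `i - 1` at every `k < i ≤ n`. -/
noncomputable def predExponent (k n : ℕ) : ℕ →₀ ℕ :=
  Finsupp.onFinset (Finset.Ioc k n) (fun i => if i ∈ Finset.Ioc k n then i - 1 else 0)
    fun i hi => by
    by_contra h
    exact hi (if_neg h)

theorem predExponent_apply {k n i : ℕ} (hi : i ∈ Finset.Ioc k n) : predExponent k n i = i - 1 :=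
  if_pos hi

open MvPolynomial in
theorem rename_antisymmWeight {k n i : ℕ} (hi : i ∈ Finset.Ioo k n) :
    rename (sT i) (antisymmWeight k n) = -antisymmWeight k n := by
  have hS : ∏ j ∈ Finset.Ioc k n, (X (sT i j) + 1 : MvPolynomial ℕ ℚ) ^ k =
      ∏ j ∈ Finset.Ioc k n, (X j + 1) ^ k :=
    Finset.prod_nbij' (sT i) (sT i) (fun j => (sT_mem_Ioc hi j).2) (fun j => (sT_mem_Ioc hi j).2)
      (fun j _ => sT_sT i j) (fun j _ => sT_sT i j) fun _ _ => rfl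
  have hD := prod_pairs_sT hi fun p q => (X q - X p : MvPolynomial ℕ ℚ)
  have hD' : ∏ p ∈ pairs k n, (X (sT i p.2) - X (sT i p.1) : MvPolynomial ℕ ℚ) =
      -∏ p ∈ pairs k n, (X p.2 - X p.1) := by
    refine mul_right_cancel₀ (X_sub_X_succ_ne_zero i) ?_
    linear_combination -hD
  simp only [antisymmWeight, map_mul, map_prod, map_pow, map_sub, map_add, rename_X, map_one]
  rw [hS, hD', mul_neg]

open MvPolynomial in
theorem shiftedEuler_antisymmWeight (k n : ℕ) :
    shiftedEuler (Finset.Ioc k n) (antisymmWeight k n) =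
      ((k * (n - k) + (pairs k n).card : ℕ) : ℚ) • antisymmWeight k n := by
  have hS := derivation_prod_of_eigenvectors (shiftedEuler (Finset.Ioc k n))
    (Finset.Ioc k n ×ˢ Finset.range k) (fun p => X p.1 + 1) fun p hp => by
      rw [map_add, shiftedEuler_X, if_pos (Finset.mem_product.1 hp).1, Derivation.map_one_eq_zero,
        add_zero]
  have hD := derivation_prod_of_eigenvectors (shiftedEuler (Finset.Ioc k n)) (pairs k n)
    (fun p => X p.2 - X p.1) fun p hp => by
      rw [mem_pairs] at hp
      rw [map_sub, shiftedEuler_X, shiftedEuler_X, if_pos (Finset.mem_Ioc.2 (by omega)),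
        if_pos (Finset.mem_Ioc.2 (by omega))]
      ring
  rw [Finset.prod_product] at hS
  simp only [Finset.prod_const, Finset.card_range, Finset.card_product, Nat.card_Ioc] at hS
  rw [antisymmWeight, Derivation.leibniz, hS, hD, smul_eq_mul, smul_eq_mul, mul_smul_comm,
    mul_smul_comm, mul_comm (∏ p ∈ pairs k n, _), ← add_smul]
  congr 1
  push_cast
  ring

open MvPolynomial in
theorem degreeOf_antisymmWeight_lt {k n : ℕ} (hkn : k < n) :
    degreeOf n (antisymmWeight k n) < n := by
  have hS : degreeOf n (∏ i ∈ Finset.Ioc k n, (X i + 1 : MvPolynomial ℕ ℚ) ^ k) ≤ k := by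
    refine (degreeOf_prod_le _ _ _).trans ?_
    have h : ∀ i ∈ Finset.Ioc k n, degreeOf n ((X i + 1 : MvPolynomial ℕ ℚ) ^ k) ≤
        if n = i then k else 0 := by
      intro i _
      refine (degreeOf_pow_le _ _ _).trans ?_
      have := degreeOf_add_le n (X i : MvPolynomial ℕ ℚ) 1
      rw [degreeOf_one, degreeOf_X] at this
      refine (Nat.mul_le_mul_left k this).trans ?_
      split_ifs <;> simp
    refine (Finset.sum_le_sum h).trans ?_
    rw [Finset.sum_ite_eq]
    split_ifs <;> omega
  have hD : degreeOf n (∏ p ∈ pairs k n, (X p.2 - X p.1 : MvPolynomial ℕ ℚ)) ≤ n - k - 1 := by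
    refine (degreeOf_prod_le _ _ _).trans ?_
    have h : ∀ p ∈ pairs k n, degreeOf n (X p.2 - X p.1 : MvPolynomial ℕ ℚ) ≤
        if n = p.2 then 1 else 0 := by
      intro p hp
      rw [mem_pairs] at hp
      refine (degreeOf_sub_le _ _ _).trans ?_
      rw [degreeOf_X, degreeOf_X, if_neg (by omega : n ≠ p.1)]
      simp
    refine (Finset.sum_le_sum h).trans ?_
    rw [sum_pairs_eq_sum_snd k n fun _ q => if n = q then 1 else 0]
    simp only [Finset.sum_const, Nat.card_Ioo, smul_eq_mul, mul_ite, mul_one, mul_zero]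
    rw [Finset.sum_ite_eq]
    split_ifs <;> omega
  have := degreeOf_mul_le n (∏ i ∈ Finset.Ioc k n, (X i + 1 : MvPolynomial ℕ ℚ) ^ k)
    (∏ p ∈ pairs k n, (X p.2 - X p.1))
  rw [antisymmWeight]
  omega

open MvPolynomial in
/-- The functional `P ↦ [X ^ B] (T P)`. -/
noncomputable def weightCoeff (k n : ℕ) (P : MvPolynomial ℕ ℚ) : ℚ :=
  coeff (predExponent k n) (antisymmWeight k n * P)

open MvPolynomial in
theorem weightCoeff_weightedDivDiff {k n : ℕ} {P : MvPolynomial ℕ ℚ} (hP : P ∈ staircase k n) :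
    weightCoeff k n (weightedDivDiff k n P) =
      weightCoeff k n (shiftedEuler (Finset.Ioc k n) P) := by
  set T := antisymmWeight k n
  set B := predExponent k n
  have h1 : weightCoeff k n (weightedDivDiff k n P) =
      ∑ i ∈ Finset.Ioo k n, (i : ℚ) * coeff (B + Finsupp.single i 1) (T * P) := by
    rw [weightCoeff, weightedDivDiff_apply, Finset.mul_sum, coeff_sum]
    refine Finset.sum_congr rfl fun i hi => ?_
    have hi' := Finset.mem_Ioo.1 hi
    rw [mul_smul_comm, coeff_smul, smul_eq_mul, coeff_mul_divDiff (rename_antisymmWeight hi)]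
    rw [predExponent_apply (Finset.mem_Ioc.2 (by omega)),
      predExponent_apply (Finset.mem_Ioc.2 (by omega))]
    omega
  have h2 : weightCoeff k n (shiftedEuler (Finset.Ioc k n) P) =
      ∑ i ∈ Finset.Ioc k n, (i : ℚ) * coeff (B + Finsupp.single i 1) (T * P) := by
    have hE : T * shiftedEuler (Finset.Ioc k n) P = shiftedEuler (Finset.Ioc k n) (T * P) -
        ((k * (n - k) + (pairs k n).card : ℕ) : ℚ) • (T * P) := by
      rw [Derivation.leibniz, shiftedEuler_antisymmWeight, smul_eq_mul, smul_eq_mul, mul_smul_comm,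
        mul_comm P]
      ring
    rw [weightCoeff, hE, coeff_sub, coeff_shiftedEuler, coeff_smul, add_comm, card_pairs_add]
    push_cast
    rw [smul_eq_mul, Finset.sum_mul, ← Finset.sum_sub_distrib]
    refine Finset.sum_congr rfl fun i hi => ?_
    have hi' := Finset.mem_Ioc.1 hi
    rw [predExponent_apply hi, Nat.cast_sub (by omega)]
    push_cast
    ring
  rw [h1, h2]
  rcases Nat.lt_or_ge k n with hkn | hkn
  · rw [← Finset.Ioo_insert_right hkn, Finset.sum_insert (by simp)]
    have : coeff (B + Finsupp.single n 1) (T * P) = 0 := by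
      rw [← notMem_support_iff]
      refine notMem_support_of_degreeOf_lt n ?_
      have h3 := degreeOf_mul_le n T P
      have h4 : degreeOf n T < n := degreeOf_antisymmWeight_lt hkn
      have h5 := mem_staircase.1 hP n (Finset.mem_Ioc.2 ⟨hkn, le_rfl⟩)
      rw [Finsupp.add_apply, predExponent_apply (Finset.mem_Ioc.2 ⟨hkn, le_rfl⟩),
        Finsupp.single_eq_same]
      omega
    rw [this, mul_zero, zero_add]
  · rw [Finset.Ioo_eq_empty (by omega), Finset.Ioc_eq_empty (by omega)]

theorem weightedDivDiff_pow_mem_staircase {k n : ℕ} {P : MvPolynomial ℕ ℚ}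
    (hP : P ∈ staircase k n) (l : ℕ) : (weightedDivDiff k n ^ l) P ∈ staircase k n := by
  induction l with
  | zero => exact hP
  | succ l ih =>
    rw [pow_succ', Module.End.mul_apply]
    exact weightedDivDiff_mem_staircase ih

theorem weightCoeff_weightedDivDiff_pow {k n : ℕ} {P : MvPolynomial ℕ ℚ}
    (hP : P ∈ staircase k n) (l : ℕ) :
    weightCoeff k n ((weightedDivDiff k n ^ l) P) =
      weightCoeff k n (fallingEnd (shiftedEuler (Finset.Ioc k n) : Module.End ℚ _) l P) := by
  induction l generalizing P with
  | zero => rfl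
  | succ l ih =>
    rw [pow_succ', Module.End.mul_apply,
      weightCoeff_weightedDivDiff (weightedDivDiff_pow_mem_staircase hP l),
      shiftedEuler_weightedDivDiff_pow, ih (Submodule.sub_mem _ (shiftedEuler_mem_staircase hP)
        (Submodule.smul_mem _ _ hP))]
    rfl

/-- The positions `(i, j)` indexing the linear factors of `stairPoly`. -/
def stairIndex (k n : ℕ) : Finset (Σ _ : ℕ, ℕ) :=
  (Finset.Ioc k n).sigma fun i => Finset.Ioc k (n + k - i)

theorem card_stairIndex (k n : ℕ) : (stairIndex k n).card = (pairs k n).card := by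
  rw [stairIndex, Finset.card_sigma, card_pairs]
  refine Finset.sum_congr rfl fun i _ => ?_
  rw [Nat.card_Ioc]
  omega

open MvPolynomial in
/-- The product of linear forms vanishing on the permutations of `{k+1, …, n}` other than the
reversal. -/
noncomputable def stairPoly (k n : ℕ) : MvPolynomial ℕ ℚ :=
  ∏ r ∈ stairIndex k n, (X r.1 - C (r.2 : ℚ))

open MvPolynomial in
theorem stairPoly_mem_staircase (k n : ℕ) : stairPoly k n ∈ staircase k n := by
  rw [mem_staircase]
  intro i hi
  refine (degreeOf_prod_le _ _ _).trans ?_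
  have h : ∀ r ∈ stairIndex k n, degreeOf i (X r.1 - C (r.2 : ℚ)) ≤ if i = r.1 then 1 else 0 := by
    intro r _
    refine (degreeOf_sub_le _ _ _).trans ?_
    rw [degreeOf_X, degreeOf_C]
    simp
  refine (Finset.sum_le_sum h).trans ?_
  rw [stairIndex, Finset.sum_sigma]
  rw [Finset.sum_eq_single_of_mem i hi fun j _ hj => Finset.sum_eq_zero fun _ _ => if_neg hj.symm]
  have := Finset.mem_Ioc.1 hi
  simp only [if_true, Finset.sum_const, Nat.card_Ioc, smul_eq_mul, mul_one]
  omega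

open MvPolynomial in
theorem totalDegree_stairPoly_le (k n : ℕ) : (stairPoly k n).totalDegree ≤ (pairs k n).card := by
  refine (totalDegree_finsetProd _ _).trans ?_
  refine (Finset.sum_le_card_nsmul _ _ 1 fun r _ => ?_).trans (by simp [card_stairIndex])
  exact (totalDegree_sub_C_le _ _).trans (totalDegree_X _).le

open MvPolynomial in
theorem fallingEnd_stairPoly (k n : ℕ) :
    fallingEnd (shiftedEuler (Finset.Ioc k n) : Module.End ℚ _) (pairs k n).card (stairPoly k n) =
      ((pairs k n).card.factorial : ℚ) • ∏ i ∈ Finset.Ioc k n, (X i + 1) ^ (n - i) := by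
  have h := fallingEnd_prod_sub (shiftedEuler (Finset.Ioc k n)) (stairIndex k n)
    (fun r => X r.1 + 1) (fun r hr => by
      rw [map_add, shiftedEuler_X, if_pos (Finset.mem_sigma.1 hr).1, Derivation.map_one_eq_zero,
        add_zero]) fun r => (r.2 : ℚ) + 1
  rw [card_stairIndex] at h
  convert h using 2
  · refine Finset.prod_congr rfl fun r _ => ?_
    rw [algebraMap_eq, map_add, map_one]
    ring
  · rw [stairIndex, Finset.prod_sigma]
    refine Finset.prod_congr rfl fun i _ => ?_
    dsimp only
    rw [Finset.prod_const, Nat.card_Ioc]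
    congr 1
    omega

open MvPolynomial in
theorem eval_divDiff (i : ℕ) (P : MvPolynomial ℕ ℚ) (v : Equiv.Perm ℕ) :
    eval (fun j => (v j : ℚ)) (divDiff i P) = (eval (fun j => (v j : ℚ)) P -
      eval (fun j => ((v * sT i) j : ℚ)) P) / ((v i : ℚ) - v (i + 1)) := by
  have h := congrArg (eval fun j => (v j : ℚ)) (mul_divDiff i P)
  rw [map_mul, map_sub, map_sub, eval_X, eval_X, eval_rename] at h
  have hne : (v i : ℚ) - v (i + 1) ≠ 0 := by
    rw [sub_ne_zero]
    exact Nat.cast_injective.ne (v.injective.ne (Nat.succ_ne_self i).symm)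
  rw [eq_div_iff hne, mul_comm, h]
  rfl

open MvPolynomial in
theorem eval_stairPoly (k n : ℕ) (v : ℕ → ℚ) :
    eval v (stairPoly k n) =
      ∏ i ∈ Finset.Ioc k n, ∏ j ∈ Finset.Ioc k (n + k - i), (v i - j) := by
  rw [stairPoly, stairIndex, Finset.prod_sigma, map_prod]
  simp

open MvPolynomial in
theorem eval_stairPoly_eq_zero {k n : ℕ} {v : Equiv.Perm ℕ}
    (hv : ∀ x ∉ Finset.Ioc k n, v x = x) (hne : v ≠ blockRev k n) :
    eval (fun j => (v j : ℚ)) (stairPoly k n) = 0 := by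
  rw [eval_stairPoly]
  by_contra h
  rw [← ne_eq, Finset.prod_ne_zero_iff] at h
  have hmem : ∀ x ∈ Finset.Ioc k n, v x ∈ Finset.Ioc k n := by
    intro x hx
    by_contra h'
    exact h' (by rwa [v.injective (hv _ h')])
  have hge : ∀ i ∈ Finset.Ioc k n, n + k + 1 - i ≤ v i := by
    intro i hi
    by_contra hlt
    have := Finset.mem_Ioc.1 (hmem i hi)
    have := Finset.mem_Ioc.1 hi
    exact h i hi (Finset.prod_eq_zero (i := v i) (Finset.mem_Ioc.2 (by omega)) (sub_self _))
  have hsum : ∑ i ∈ Finset.Ioc k n, (n + k + 1 - i) = ∑ i ∈ Finset.Ioc k n, v i := by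
    have e1 : ∑ i ∈ Finset.Ioc k n, v i = ∑ i ∈ Finset.Ioc k n, i := by
      refine Finset.sum_nbij v hmem v.injective.injOn ?_ fun _ _ => rfl
      exact Finset.surjOn_of_injOn_of_card_le v hmem v.injective.injOn le_rfl
    rw [e1]
    refine Finset.sum_nbij' (fun i => n + k + 1 - i) (fun i => n + k + 1 - i) ?_ ?_ ?_ ?_ ?_ <;>
      simp <;> omega
  have heq := (Finset.sum_eq_sum_iff_of_le hge).1 hsum
  refine hne (Equiv.ext fun x => ?_)
  rw [blockRev_apply]
  split_ifs with hx
  · exact (heq x (Finset.mem_Ioc.2 hx)).symm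
  · exact hv x (by simpa using hx)

open MvPolynomial in
theorem eval_stairPoly_blockRev (k n : ℕ) :
    eval (fun j => (blockRev k n j : ℚ)) (stairPoly k n) = ascProd k n 1 := by
  have h : ascProd k n 1 = ∏ p ∈ pairs k n, ((p.2 : ℚ) - p.1) :=
    Finset.prod_congr rfl fun p hp => if_pos (mem_pairs.1 hp).2.1
  rw [eval_stairPoly, h, prod_pairs_eq_prod_fst k n fun p q => (q : ℚ) - p]
  refine Finset.prod_congr rfl fun i hi => ?_
  rw [Finset.mem_Ioc] at hi
  rw [blockRev_apply, if_pos hi]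
  refine Finset.prod_nbij' (fun j => n + k + 1 - j) (fun j => n + k + 1 - j) ?_ ?_ ?_ ?_ ?_
  iterate 4
    intro j hj
    rw [Finset.mem_Ioc] at *
    omega
  intro j hj
  rw [Finset.mem_Ioc] at hj
  rw [Nat.cast_sub (by omega), Nat.cast_sub (by omega)]
  ring

open MvPolynomial in
theorem factorial_mul_weightCoeff_le (k n : ℕ) (h1 : weightCoeff k n 1 = 1) :
    ((pairs k n).card.factorial : ℚ) *
        weightCoeff k n (∏ i ∈ Finset.Ioc k n, (X i + 1) ^ (n - i)) ≤
      wordSum (Finset.Ioo k n) (pairs k n).card (blockRev k n) := by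
  have hdeg := totalDegree_weightedDivDiff_pow_le k n (pairs k n).card (stairPoly k n)
  rw [Nat.sub_eq_zero_of_le (totalDegree_stairPoly_le k n), Nat.le_zero,
    totalDegree_eq_zero_iff_eq_C] at hdeg
  set a := coeff 0 ((weightedDivDiff k n ^ (pairs k n).card) (stairPoly k n))
  have hΦ := weightCoeff_weightedDivDiff_pow (stairPoly_mem_staircase k n) (pairs k n).card
  rw [fallingEnd_stairPoly, hdeg, weightCoeff, weightCoeff, mul_comm, coeff_C_mul, mul_smul_comm,
    coeff_smul, smul_eq_mul] at hΦ
  rw [weightCoeff, mul_one] at h1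
  rw [h1, mul_one] at hΦ
  rw [weightCoeff, ← hΦ]
  have h := dividedDifference_iterate_le k n
    (fun l v => eval (fun j => (v j : ℚ)) ((weightedDivDiff k n ^ l) (stairPoly k n)))
    (fun v hv hne => eval_stairPoly_eq_zero hv hne) (eval_stairPoly_blockRev k n) fun l v => by
      rw [pow_succ', Module.End.mul_apply, weightedDivDiff_apply, map_sum]
      refine Finset.sum_congr rfl fun i _ => ?_
      rw [smul_eval, eval_divDiff]
  rwa [hdeg, eval_C] at h

theorem prod_Ioc_eq_prod_fin {M : Type*} [CommMonoid M] (k m : ℕ) (F : ℕ → M) :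
    ∏ i ∈ Finset.Ioc k (k + m), F i = ∏ a : Fin m, F (k + 1 + a) := by
  symm
  refine Finset.prod_bij (fun a _ => k + 1 + a) ?_ ?_ ?_ fun _ _ => rfl
  · intro a _
    rw [Finset.mem_Ioc]
    omega
  · intro a _ b _ h
    ext
    omega
  · intro i hi
    rw [Finset.mem_Ioc] at hi
    exact ⟨⟨i - (k + 1), by omega⟩, Finset.mem_univ _, by dsimp only; omega⟩

theorem prod_pairs_eq_prod_fin {M : Type*} [CommMonoid M] (k m : ℕ) (F : ℕ → ℕ → M) :
    ∏ p ∈ pairs k (k + m), F p.1 p.2 =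
      ∏ a : Fin m, ∏ b ∈ Finset.Ioi a, F (k + 1 + a) (k + 1 + b) := by
  rw [prod_pairs_eq_prod_fst, prod_Ioc_eq_prod_fin]
  refine Finset.prod_congr rfl fun a _ => ?_
  symm
  refine Finset.prod_bij (fun b _ => k + 1 + b) ?_ ?_ ?_ fun _ _ => rfl
  · intro b hb
    rw [Finset.mem_Ioi, Fin.lt_def] at hb
    rw [Finset.mem_Ioc]
    omega
  · intro b _ c _ h
    ext
    omega
  · intro i hi
    rw [Finset.mem_Ioc] at hi
    refine ⟨⟨i - (k + 1), by omega⟩, ?_, by dsimp only; omega⟩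
    rw [Finset.mem_Ioi, Fin.lt_def]
    dsimp only
    omega

open MvPolynomial in
/-- The coefficient of a product of univariate polynomials in distinct variables. -/
theorem coeff_prod_aeval_X {ι : Type*} [Fintype ι] [DecidableEq ι] {x : ι → ℕ}
    (hx : Function.Injective x) (p : ι → Polynomial ℚ) (B : ι → ℕ) :
    coeff (∑ i, Finsupp.single (x i) (B i))
      (∏ i, Polynomial.aeval (X (x i) : MvPolynomial ℕ ℚ) (p i)) = ∏ i, (p i).coeff (B i) := by
  have h : ∀ i, Polynomial.aeval (X (x i) : MvPolynomial ℕ ℚ) (p i) =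
      ∑ s ∈ Finset.range ((p i).natDegree + B i + 1), (p i).coeff s • X (x i) ^ s :=
    fun i => Polynomial.aeval_eq_sum_range' (by omega) _
  simp only [h]
  rw [Finset.prod_univ_sum, coeff_sum]
  have hterm : ∀ g : ι → ℕ, coeff (∑ i, Finsupp.single (x i) (B i))
      (∏ i, (p i).coeff (g i) • (X (x i) : MvPolynomial ℕ ℚ) ^ g i) =
        if g = B then ∏ i, (p i).coeff (B i) else 0 := by
    intro g
    have h1 : ∏ i, (X (x i) : MvPolynomial ℕ ℚ) ^ g i =
        monomial (∑ i, Finsupp.single (x i) (g i)) 1 := by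
      rw [monomial_sum_one]
      simp only [X_pow_eq_monomial]
    rw [Finset.prod_smul, coeff_smul, h1, coeff_monomial]
    have h2 : (∑ i, Finsupp.single (x i) (g i) = ∑ i, Finsupp.single (x i) (B i)) ↔ g = B := by
      constructor
      · intro h
        funext j
        have := DFunLike.congr_fun h (x j)
        simpa [Finsupp.finsetSum_apply, Finsupp.single_apply, hx.eq_iff] using this
      · rintro rfl
        rfl
    simp only [h2]
    split_ifs with hg
    · rw [hg, smul_eq_mul, mul_one]
    · rw [smul_zero]
  simp only [hterm]
  rw [Finset.sum_ite_eq', if_pos]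
  rw [Fintype.mem_piFinset]
  intro i
  rw [Finset.mem_range]
  omega

theorem predExponent_eq_sum (k m : ℕ) :
    predExponent k (k + m) = ∑ a : Fin m, Finsupp.single (k + 1 + a) (k + a) := by
  ext x
  rw [Finsupp.finsetSum_apply]
  by_cases hx : x ∈ Finset.Ioc k (k + m)
  · have hx' := Finset.mem_Ioc.1 hx
    rw [predExponent_apply hx, Finset.sum_eq_single_of_mem ⟨x - (k + 1), by omega⟩
      (Finset.mem_univ _)]
    · dsimp only
      rw [Finsupp.single_apply, if_pos (by omega)]
      omega
    · intro b _ hb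
      refine Finsupp.single_eq_of_ne fun h => hb ?_
      ext
      dsimp only
      omega
  · have : predExponent k (k + m) x = 0 := if_neg hx
    rw [this, Finset.sum_eq_zero]
    intro a _
    refine Finsupp.single_eq_of_ne fun h => hx ?_
    rw [Finset.mem_Ioc]
    omega

open MvPolynomial in
theorem weightCoeff_prod (k m : ℕ) (g : ℕ → ℕ) :
    weightCoeff k (k + m) (∏ i ∈ Finset.Ioc k (k + m), (X i + 1) ^ g i) =
      (Matrix.of fun a b : Fin m => if (b : ℕ) ≤ k + a then
        ((k + g (k + 1 + a)).choose (k + a - b) : ℚ) else 0).det := by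
  have hinj : Function.Injective fun a : Fin m => k + 1 + (a : ℕ) := fun a b h => by
    ext
    dsimp only at h
    omega
  have hV : ∏ p ∈ pairs k (k + m), (X p.2 - X p.1 : MvPolynomial ℕ ℚ) =
      ∑ σ : Equiv.Perm (Fin m), (Equiv.Perm.sign σ : ℤ) •
        ∏ a : Fin m, X (k + 1 + (a : ℕ)) ^ (σ a : ℕ) := by
    rw [prod_pairs_eq_prod_fin k m fun p q => (X q - X p : MvPolynomial ℕ ℚ),
      ← Matrix.det_vandermonde fun a : Fin m => (X (k + 1 + (a : ℕ)) : MvPolynomial ℕ ℚ),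
      ← Matrix.det_transpose, Matrix.det_apply]
    rfl
  rw [weightCoeff, antisymmWeight, mul_right_comm, ← Finset.prod_mul_distrib, prod_Ioc_eq_prod_fin,
    hV, Finset.mul_sum, coeff_sum, ← Matrix.det_transpose, Matrix.det_apply]
  refine Finset.sum_congr rfl fun σ _ => ?_
  rw [mul_smul_comm, ← Finset.prod_mul_distrib, predExponent_eq_sum]
  have h := coeff_prod_aeval_X hinj (fun a => (Polynomial.X + 1) ^ (k + g (k + 1 + a)) *
    Polynomial.X ^ (σ a : ℕ)) fun a => k + a
  simp only [map_mul, map_pow, map_add, map_one, Polynomial.aeval_X, pow_add] at h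
  rw [Units.smul_def, coeff_smul, h]
  congr 1
  refine Finset.prod_congr rfl fun a _ => ?_
  rw [← pow_add, Polynomial.coeff_mul_X_pow', Polynomial.coeff_X_add_one_pow]
  rfl

theorem weightCoeff_one (k m : ℕ) : weightCoeff k (k + m) 1 = 1 := by
  have h := weightCoeff_prod k m fun _ => 0
  simp only [pow_zero, Finset.prod_const_one] at h
  rw [h, Matrix.det_of_isUpperTriangular]
  · refine Finset.prod_eq_one fun a _ => ?_
    simp
  · intro a b hab
    rw [id, id, Fin.lt_def] at hab
    rw [Matrix.of_apply, if_pos (by omega), Nat.choose_eq_zero_of_lt (by omega), Nat.cast_zero]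

open Polynomial in
theorem det_eval_add_const {R : Type*} [CommRing R] {m : ℕ} (q : Fin m → R[X])
    (hq : ∀ b, (q b).natDegree < m) (v : Fin m → R) (c : R) :
    (Matrix.of fun a b => (q b).eval (v a + c)).det =
      (Matrix.of fun a b => (q b).eval (v a)).det := by
  have h : ∀ w : Fin m → R, (Matrix.of fun a b => (q b).eval (w a)).det =
      (Matrix.vandermonde w).det * (Matrix.of fun a b : Fin m => (q b).coeff a).det := by
    intro w
    rw [← Matrix.det_mul]
    congr 1
    ext a b
    rw [Matrix.of_apply, Matrix.mul_apply, Polynomial.eval_eq_sum_range' (hq b),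
      ← Fin.sum_univ_eq_sum_range (fun i => (q b).coeff i * w a ^ i) m]
    exact Finset.sum_congr rfl fun i _ => mul_comm _ _
  rw [h, h, Matrix.det_vandermonde_add]

theorem choose_mul_factorials (k m a b : ℕ) (ha : a < m) (hb : b < m) :
    (if b ≤ k + a then (k + (m - 1 - a)).choose (k + a - b) else 0) *
        ((k + a).factorial * (2 * (m - 1 - a)).factorial) =
      (k + (m - 1 - a)).factorial *
        ((k + a).descFactorial b * (2 * (m - 1 - a)).descFactorial (m - 1 - b)) := by
  split_ifs with h
  · by_cases h2 : m - 1 - b ≤ 2 * (m - 1 - a)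
    · rw [← Nat.factorial_mul_descFactorial h, ← Nat.factorial_mul_descFactorial h2,
        ← Nat.choose_mul_factorial_mul_factorial (show k + a - b ≤ k + (m - 1 - a) by omega),
        show k + (m - 1 - a) - (k + a - b) = 2 * (m - 1 - a) - (m - 1 - b) by omega]
      ring
    · rw [Nat.choose_eq_zero_of_lt (by omega), Nat.descFactorial_of_lt (by omega : _ < m - 1 - b)]
      ring
  · rw [Nat.descFactorial_of_lt (by omega : _ < b)]
    ring

open Polynomial in
theorem det_descFactorial (k m : ℕ) :
    (Matrix.of fun a b : Fin m => (((k + (a : ℕ)).descFactorial b *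
      (2 * (m - 1 - (a : ℕ))).descFactorial (m - 1 - b) : ℕ) : ℚ)).det =
      ∏ a : Fin m, (((a : ℕ).factorial *
        (2 * k + 2 * (m - 1 - (a : ℕ))).descFactorial (m - 1 - a) : ℕ) : ℚ) := by
  let q : Fin m → ℚ[X] := fun b => (descPochhammer ℚ b).comp (X + C (k : ℚ)) *
    (descPochhammer ℚ (m - 1 - b)).comp (C (2 * (m - 1 : ℚ)) - C 2 * X)
  have hq : ∀ b, (q b).natDegree < m := by
    intro b
    have h1 : (X + C (k : ℚ)).natDegree = 1 := natDegree_X_add_C _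
    have h2 : (C (2 * (m - 1 : ℚ)) - C 2 * X).natDegree ≤ 1 := by
      compute_degree
    have h3 : ((descPochhammer ℚ (m - 1 - b)).comp (C (2 * (m - 1 : ℚ)) - C 2 * X)).natDegree ≤
        (m - 1 - b) * 1 := by
      refine natDegree_comp_le.trans ?_
      rw [descPochhammer_natDegree]
      exact Nat.mul_le_mul_left _ h2
    refine natDegree_mul_le.trans_lt ?_
    rw [natDegree_comp, h1, descPochhammer_natDegree]
    omega
  have hcast : ∀ a : Fin m, ((m - 1 - (a : ℕ) : ℕ) : ℚ) = m - 1 - a := fun a => by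
    rw [Nat.cast_sub (by have := a.2; omega : (a : ℕ) ≤ m - 1),
      Nat.cast_sub (by have := a.2; omega : 1 ≤ m), Nat.cast_one]
  have h := det_eval_add_const q hq (fun a => ((a : ℕ) : ℚ) - k) k
  have hl : (Matrix.of fun a b : Fin m => (((k + (a : ℕ)).descFactorial b *
      (2 * (m - 1 - (a : ℕ))).descFactorial (m - 1 - b) : ℕ) : ℚ)) =
      Matrix.of fun a b : Fin m => (q b).eval (((a : ℕ) : ℚ) - k + k) := by
    ext a b
    rw [Matrix.of_apply, Matrix.of_apply, Nat.cast_mul, ← descPochhammer_eval_eq_descFactorial,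
      ← descPochhammer_eval_eq_descFactorial, eval_mul, eval_comp, eval_comp]
    congr 2
    · simp [add_comm]
    · push_cast [hcast]
      simp
      ring
  have hr : (Matrix.of fun a b : Fin m => (q b).eval (((a : ℕ) : ℚ) - k)) =
      Matrix.of fun a b : Fin m => (((a : ℕ).descFactorial b *
        (2 * k + 2 * (m - 1 - (a : ℕ))).descFactorial (m - 1 - b) : ℕ) : ℚ) := by
    ext a b
    rw [Matrix.of_apply, Matrix.of_apply, Nat.cast_mul, ← descPochhammer_eval_eq_descFactorial,
      ← descPochhammer_eval_eq_descFactorial, eval_mul, eval_comp, eval_comp]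
    congr 2
    · simp
    · push_cast [hcast]
      simp
      ring
  rw [hl, h, hr, Matrix.det_of_isLowerTriangular]
  · simp only [Matrix.of_apply, Nat.descFactorial_self]
  · intro a b hab
    rw [OrderDual.toDual_lt_toDual, Fin.lt_def] at hab
    rw [Matrix.of_apply, Nat.descFactorial_of_lt hab, zero_mul, Nat.cast_zero]

open Nat in
/-- The factor gained when passing from `k` to `k + m`. -/
def growthFactor (k m : ℕ) : ℚ :=
  ∏ i ∈ Finset.range m, ((i ! * (2 * k + 2 * i)! : ℕ) : ℚ) / (((2 * i)! * (2 * k + i)! : ℕ) : ℚ)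

open MvPolynomial Nat in
theorem weightCoeff_stairs (k m : ℕ) :
    weightCoeff k (k + m) (∏ i ∈ Finset.Ioc k (k + m), (X i + 1) ^ (k + m - i)) =
      growthFactor k m := by
  rw [weightCoeff_prod k m fun i => k + m - i]
  have hent : (Matrix.of fun a b : Fin m => if (b : ℕ) ≤ k + a then
      ((k + (k + m - (k + 1 + (a : ℕ)))).choose (k + a - b) : ℚ) else 0) =
      Matrix.of fun a b : Fin m => (((k + (m - 1 - (a : ℕ)))! : ℚ) /
        ((k + a)! * (2 * (m - 1 - (a : ℕ)))! : ℕ)) *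
        (Matrix.of fun a b : Fin m => (((k + (a : ℕ)).descFactorial b *
          (2 * (m - 1 - (a : ℕ))).descFactorial (m - 1 - b) : ℕ) : ℚ)) a b := by
    ext a b
    have h := choose_mul_factorials k m a b a.2 b.2
    have hpos : (((k + a)! * (2 * (m - 1 - (a : ℕ)))! : ℕ) : ℚ) ≠ 0 := by positivity
    rw [Matrix.of_apply, Matrix.of_apply, Matrix.of_apply, div_mul_eq_mul_div, eq_div_iff hpos,
      show k + m - (k + 1 + (a : ℕ)) = m - 1 - a by omega]
    exact_mod_cast h
  rw [hent, Matrix.det_mul_column, det_descFactorial, ← Finset.prod_mul_distrib,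
    Fin.prod_univ_eq_prod_range (fun a => (((k + (m - 1 - a))! : ℚ) /
        ((k + a)! * (2 * (m - 1 - a))! : ℕ)) * ((a ! *
        (2 * k + 2 * (m - 1 - a)).descFactorial (m - 1 - a) : ℕ) : ℚ)) m]
  have hd : ∀ i, ((2 * k + 2 * i).descFactorial i : ℚ) = (2 * k + 2 * i)! / (2 * k + i)! := by
    intro i
    rw [eq_div_iff (by positivity), mul_comm]
    have := Nat.factorial_mul_descFactorial (show i ≤ 2 * k + 2 * i by omega)
    rw [show 2 * k + 2 * i - i = 2 * k + i by omega] at this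
    exact_mod_cast this
  push_cast [hd]
  simp only [Finset.prod_mul_distrib, Finset.prod_div_distrib, growthFactor, Nat.cast_mul]
  rw [Finset.prod_range_reflect (fun i => ((k + i)! : ℚ)) m,
    Finset.prod_range_reflect (fun i => ((2 * i)! : ℚ)) m,
    Finset.prod_range_reflect (fun i => ((2 * k + 2 * i)! : ℚ)) m,
    Finset.prod_range_reflect (fun i => ((2 * k + i)! : ℚ)) m]
  have h1 : ∏ i ∈ Finset.range m, ((k + i)! : ℚ) ≠ 0 :=
    Finset.prod_ne_zero_iff.2 fun i _ => by positivity
  field_simp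

theorem factorial_mul_growthFactor_le (k m : ℕ) :
    ((pairs k (k + m)).card.factorial : ℚ) * growthFactor k m ≤
      wordSum (Finset.Ioo k (k + m)) (pairs k (k + m)).card (blockRev k (k + m)) := by
  rw [← weightCoeff_stairs]
  exact factorial_mul_weightCoeff_le k (k + m) (weightCoeff_one k m)

theorem Upsilon_le_exp (n : ℕ) (w : Equiv.Perm ℕ) :
    ((Upsilon n w : ℚ) : ℝ) ≤ Real.exp ((n : ℝ) ^ 2) := by
  have h1 : Upsilon n w ≤ ((len n w).factorial : ℚ)⁻¹ * ((n : ℚ) ^ 2) ^ len n w := by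
    classical
    refine mul_le_mul_of_nonneg_left ?_ (by positivity)
    refine (Finset.sum_le_sum_of_subset_of_nonneg (Finset.filter_subset _ _)
      fun a _ _ => Finset.prod_nonneg fun i _ => Nat.cast_nonneg _).trans ?_
    rw [← Fintype.sum_pow fun j : Fin n => ((j : ℕ) : ℚ)]
    refine pow_le_pow_left₀ (Finset.sum_nonneg fun i _ => Nat.cast_nonneg _) ?_ _
    refine (Finset.sum_le_card_nsmul _ _ (n : ℚ) fun j _ => ?_).trans ?_
    · exact_mod_cast j.2.le
    · simp [sq]
  refine le_trans ?_ (Real.pow_div_factorial_le_exp _ (by positivity) (len n w))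
  rw [div_eq_inv_mul]
  have h2 := (Rat.cast_le (K := ℝ)).2 h1
  push_cast at h2
  exact h2

theorem bddAbove_Upsilon (n : ℕ) :
    BddAbove ((fun w => ((Upsilon n w : ℚ) : ℝ)) '' SymmOn n) := by
  refine ⟨Real.exp ((n : ℝ) ^ 2), ?_⟩
  rintro _ ⟨w, _, rfl⟩
  exact Upsilon_le_exp n w

theorem one_le_u (n : ℕ) : 1 ≤ u n := by
  refine le_csSup (bddAbove_Upsilon n) ⟨1, fun _ _ => rfl, ?_⟩
  have h : len n 1 = 0 := by
    rw [len, Finset.card_eq_zero, Finset.filter_eq_empty_iff]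
    intro p _ hp
    exact lt_asymm hp.1 hp.2
  dsimp only
  rw [Upsilon_eq_wordSum, h]
  simp [wordSum]

theorem log_u_nonneg (n : ℕ) : 0 ≤ Real.log (u n) := Real.log_nonneg (one_le_u n)

theorem log_u_le (n : ℕ) : Real.log (u n) ≤ (n : ℝ) ^ 2 := by
  rw [Real.log_le_iff_le_exp (one_pos.trans_le (one_le_u n))]
  refine csSup_le ⟨_, ⟨1, fun _ _ => rfl, rfl⟩⟩ ?_
  rintro _ ⟨w, _, rfl⟩
  exact Upsilon_le_exp n w

theorem growthFactor_pos (k m : ℕ) : 0 < growthFactor k m :=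
  Finset.prod_pos fun i _ => by positivity

theorem u_mul_growthFactor_le (k m : ℕ) : u k * (growthFactor k m : ℝ) ≤ u (k + m) := by
  have hpos : (0 : ℝ) < growthFactor k m := by exact_mod_cast growthFactor_pos k m
  rw [← le_div_iff₀ hpos]
  refine csSup_le ⟨_, ⟨1, fun _ _ => rfl, rfl⟩⟩ ?_
  rintro _ ⟨w, hw, rfl⟩
  rw [le_div_iff₀ hpos]
  refine le_trans ?_ (le_csSup (bddAbove_Upsilon (k + m))
    ⟨_, mul_blockRev_mem_SymmOn (Nat.le_add_right k m) hw, rfl⟩)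
  dsimp only
  exact_mod_cast Upsilon_mul_le (Nat.le_add_right k m) hw (factorial_mul_growthFactor_le k m)

open Nat in
theorem le_log_factorial (N : ℕ) : N * Real.log N - N ≤ Real.log (N ! : ℝ) := by
  induction N with
  | zero => simp
  | succ N ih =>
    rcases Nat.eq_zero_or_pos N with rfl | hN
    · simp
    have hN' : (0 : ℝ) < N := by exact_mod_cast hN
    have h := Real.log_le_sub_one_of_pos (show (0 : ℝ) < (N + 1) / N by positivity)
    rw [Real.log_div (by positivity) hN'.ne'] at h
    have h2 : (N : ℝ) * (Real.log (N + 1) - Real.log N) ≤ N * ((N + 1) / N - 1) :=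
      mul_le_mul_of_nonneg_left h hN'.le
    have h3 : (N : ℝ) * ((N + 1) / N - 1) = 1 := by field_simp; ring
    rw [Nat.factorial_succ]
    push_cast
    rw [Real.log_mul (by positivity) (by positivity)]
    linarith

open Nat in
theorem log_factorial_le {N : ℕ} (hN : 1 ≤ N) :
    Real.log (N ! : ℝ) ≤ N * Real.log N - N + Real.log N + 1 := by
  induction N, hN using Nat.le_induction with
  | base => simp
  | succ N hN ih =>
    have hN' : (0 : ℝ) < N := by exact_mod_cast hN
    have h := Real.one_sub_inv_le_log_of_pos (show (0 : ℝ) < (N + 1) / N by positivity)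
    rw [Real.log_div (by positivity) hN'.ne', inv_div] at h
    have h2 := mul_le_mul_of_nonneg_left h (by positivity : (0 : ℝ) ≤ N + 1)
    have h3 : ((N : ℝ) + 1) * (1 - N / (N + 1)) = 1 := by field_simp; ring
    rw [Nat.factorial_succ]
    push_cast
    rw [Real.log_mul (by positivity) (by positivity)]
    linarith

theorem mul_log_sub_mono {a b : ℝ} (ha : 1 ≤ a) (hab : a ≤ b) :
    a * Real.log a - a ≤ b * Real.log b - b := by
  have ha0 : 0 < a := by linarith
  have hb0 : 0 < b := by linarith
  have h := Real.one_sub_inv_le_log_of_pos (div_pos hb0 ha0)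
  rw [Real.log_div hb0.ne' ha0.ne', inv_div] at h
  have h2 := mul_le_mul_of_nonneg_left h hb0.le
  have h3 : b * (1 - a / b) = b - a := by field_simp
  have h4 : 0 ≤ (b - a) * Real.log a := mul_nonneg (by linarith) (Real.log_nonneg ha)
  linarith

/-- A primitive of `x log x - x`. -/
noncomputable def logPrimitive (x : ℝ) : ℝ := x ^ 2 / 2 * Real.log x - 3 * x ^ 2 / 4

theorem hasDerivAt_logPrimitive {x : ℝ} (hx : x ≠ 0) :
    HasDerivAt logPrimitive (x * Real.log x - x) x := by
  have h := (((hasDerivAt_pow 2 x).div_const 2).mul (Real.hasDerivAt_log hx)).sub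
    (((hasDerivAt_pow 2 x).const_mul 3).div_const 4)
  refine h.congr_deriv ?_
  push_cast
  field_simp
  ring

theorem logPrimitive_succ_sub {N : ℕ} (hN : 1 ≤ N) :
    N * Real.log N - N ≤ logPrimitive (N + 1) - logPrimitive N ∧
      logPrimitive (N + 1) - logPrimitive N ≤ (N + 1) * Real.log (N + 1) - (N + 1) := by
  have hN' : (1 : ℝ) ≤ N := by exact_mod_cast hN
  obtain ⟨c, hc, h⟩ := exists_hasDerivAt_eq_slope logPrimitive (fun x => x * Real.log x - x)
    (show (N : ℝ) < N + 1 by linarith)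
    (fun x hx => (hasDerivAt_logPrimitive (by linarith [hx.1])).continuousAt.continuousWithinAt)
    (fun x hx => hasDerivAt_logPrimitive (by linarith [hx.1]))
  rw [add_sub_cancel_left, div_one] at h
  rw [← h]
  exact ⟨mul_log_sub_mono hN' hc.1.le, mul_log_sub_mono (by linarith [hc.1]) hc.2.le⟩

open Nat in
/-- The logarithm of the superfactorial `∏ i < N, i!`. -/
noncomputable def logSuperfactorial (N : ℕ) : ℝ := ∑ i ∈ Finset.range N, Real.log (i ! : ℝ)

theorem le_logSuperfactorial (N : ℕ) :
    logPrimitive N - N * (Real.log N + 1) ≤ logSuperfactorial N := by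
  suffices logPrimitive N - N * Real.log N ≤ logSuperfactorial N by
    have : (0 : ℝ) ≤ N := Nat.cast_nonneg N
    linarith
  induction N with
  | zero => simp [logPrimitive, logSuperfactorial]
  | succ N ih =>
    rcases Nat.eq_zero_or_pos N with rfl | hN
    · simp [logPrimitive, logSuperfactorial]
      norm_num
    rw [logSuperfactorial, Finset.sum_range_succ, ← logSuperfactorial]
    have h1 := (logPrimitive_succ_sub hN).2
    have h2 := le_log_factorial N
    push_cast
    linarith

theorem logSuperfactorial_le (N : ℕ) :
    logSuperfactorial N ≤ logPrimitive N + N * (Real.log N + 1) := by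
  induction N with
  | zero => simp [logPrimitive, logSuperfactorial]
  | succ N ih =>
    rcases Nat.eq_zero_or_pos N with rfl | hN
    · simp [logPrimitive, logSuperfactorial]
      norm_num
    rw [logSuperfactorial, Finset.sum_range_succ, ← logSuperfactorial]
    have h1 := (logPrimitive_succ_sub hN).1
    have h2 := log_factorial_le hN
    have hN' : (0 : ℝ) < N := by exact_mod_cast hN
    have h3 : ((N : ℝ) + 1) * Real.log N ≤ (N + 1) * Real.log (N + 1) :=
      mul_le_mul_of_nonneg_left (Real.log_le_log hN' (by linarith)) (by linarith)
    push_cast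
    linarith

open Nat in
theorem four_pow_mul_sq_le (j : ℕ) (hj : 1 ≤ j) : 4 ^ j * (j ! * j !) ≤ 2 * j * (2 * j)! := by
  have h := Nat.four_pow_le_two_mul_self_mul_centralBinom j hj
  have h2 : (2 * j)! = j.centralBinom * (j ! * j !) := by
    have := Nat.choose_mul_factorial_mul_factorial (show j ≤ 2 * j by omega)
    rw [show 2 * j - j = j by omega] at this
    rw [Nat.centralBinom, ← this, mul_assoc]
  rw [h2, ← mul_assoc (2 * j)]
  exact Nat.mul_le_mul_right _ h

open Nat in
theorem factorial_two_mul_le_four_pow (j : ℕ) : (2 * j)! ≤ 4 ^ j * (j ! * j !) := by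
  have h2 : (2 * j)! = j.centralBinom * (j ! * j !) := by
    have := Nat.choose_mul_factorial_mul_factorial (show j ≤ 2 * j by omega)
    rw [show 2 * j - j = j by omega] at this
    rw [Nat.centralBinom, ← this, mul_assoc]
  rw [h2]
  refine Nat.mul_le_mul_right _ ?_
  have := Nat.choose_le_two_pow (2 * j) j
  rwa [pow_mul] at this

open Nat in
theorem log_growthFactor (k m : ℕ) :
    Real.log (growthFactor k m : ℝ) = ∑ i ∈ Finset.range m, (Real.log (i ! : ℝ) +
      Real.log ((2 * k + 2 * i)! : ℝ) -
        (Real.log ((2 * i)! : ℝ) + Real.log ((2 * k + i)! : ℝ))) := by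
  rw [growthFactor]
  push_cast
  rw [Real.log_prod fun i _ => by positivity]
  refine Finset.sum_congr rfl fun i _ => ?_
  rw [Real.log_div (by positivity) (by positivity), Real.log_mul (by positivity) (by positivity),
    Real.log_mul (by positivity) (by positivity)]

theorem sum_range_log_factorial_add (a m : ℕ) :
    ∑ i ∈ Finset.range m, Real.log ((a + i).factorial : ℝ) =
      logSuperfactorial (a + m) - logSuperfactorial a := by
  rw [logSuperfactorial, logSuperfactorial, Finset.sum_range_add, add_sub_cancel_left]

open Nat in
theorem le_log_growthFactor {k m : ℕ} (hk : 1 ≤ k) :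
    2 * k * m * Real.log 2 - m * Real.log (2 * (k + m)) +
      2 * (logSuperfactorial (k + m) - logSuperfactorial k) - logSuperfactorial m -
      (logSuperfactorial (2 * k + m) - logSuperfactorial (2 * k)) ≤
    Real.log (growthFactor k m : ℝ) := by
  rw [log_growthFactor, ← sum_range_log_factorial_add, ← sum_range_log_factorial_add]
  have hterm : ∀ i ∈ Finset.range m, (2 * k * Real.log 2 - Real.log (2 * (k + m)) +
      2 * Real.log ((k + i)! : ℝ) - Real.log (i ! : ℝ) - Real.log ((2 * k + i)! : ℝ)) ≤
      Real.log (i ! : ℝ) + Real.log ((2 * k + 2 * i)! : ℝ) -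
        (Real.log ((2 * i)! : ℝ) + Real.log ((2 * k + i)! : ℝ)) := by
    intro i hi
    rw [Finset.mem_range] at hi
    have hi' : (i : ℝ) ≤ m := by exact_mod_cast hi.le
    have hk' : (1 : ℝ) ≤ k := by exact_mod_cast hk
    have h4 : Real.log 4 = 2 * Real.log 2 := by
      rw [show (4 : ℝ) = 2 ^ 2 by norm_num, Real.log_pow]
      norm_num
    have h1 := Real.log_le_log (by positivity)
      (Nat.cast_le (α := ℝ).2 (four_pow_mul_sq_le (k + i) (by omega)))
    have h2 := Real.log_le_log (by positivity)
      (Nat.cast_le (α := ℝ).2 (factorial_two_mul_le_four_pow i))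
    push_cast at h1 h2
    rw [Real.log_mul (by positivity) (by positivity), Real.log_mul (by positivity) (by positivity),
      Real.log_mul (by positivity) (by positivity), Real.log_pow, h4, mul_add 2 k i] at h1
    rw [Real.log_mul (by positivity) (by positivity), Real.log_mul (by positivity) (by positivity),
      Real.log_pow, h4] at h2
    have h3 : Real.log (2 * (k + i)) ≤ Real.log (2 * (k + m)) :=
      Real.log_le_log (by positivity) (by linarith)
    push_cast at h1
    linarith
  refine le_trans (le_of_eq ?_) (Finset.sum_le_sum hterm)
  simp only [Finset.sum_sub_distrib, Finset.sum_add_distrib, Finset.sum_const, Finset.card_range,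
    nsmul_eq_mul, ← Finset.mul_sum, logSuperfactorial]
  ring

theorem logPrimitive_identity {k m : ℝ} (hk : 0 < k) (hm : 0 < m) :
    2 * k * m * Real.log 2 + 2 * (logPrimitive (k + m) - logPrimitive k) - logPrimitive m -
      (logPrimitive (2 * k + m) - logPrimitive (2 * k)) = (k + m) ^ 2 * f (k / (k + m)) := by
  have hn : 0 < k + m := by positivity
  have h1 : 1 - k / (k + m) = m / (k + m) := by field_simp; ring
  have h2 : 1 + k / (k + m) = (2 * k + m) / (k + m) := by field_simp; ring
  rw [f, h1, h2, Real.log_div hk.ne' hn.ne', Real.log_div hm.ne' hn.ne',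
    Real.log_div (by positivity) hn.ne']
  simp only [logPrimitive]
  rw [Real.log_mul two_ne_zero hk.ne']
  field_simp
  ring

theorem le_log_growthFactor_of_pos {k m : ℕ} (hk : 1 ≤ k) (hm : 1 ≤ m) :
    ((k + m : ℕ) : ℝ) ^ 2 * f (k / (k + m : ℕ)) -
      15 * (k + m : ℕ) * (Real.log (2 * (k + m : ℕ)) + 1) ≤ Real.log (growthFactor k m : ℝ) := by
  have hk' : (1 : ℝ) ≤ k := by exact_mod_cast hk
  have hm' : (1 : ℝ) ≤ m := by exact_mod_cast hm
  set L := Real.log (2 * (k + m : ℕ)) with hL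
  have hL0 : 0 ≤ L := Real.log_nonneg (by push_cast; linarith)
  have hE : ∀ N : ℕ, N ≤ 2 * (k + m) → (N : ℝ) * (Real.log N + 1) ≤ N * (L + 1) := by
    intro N hN
    rcases Nat.eq_zero_or_pos N with rfl | hN0
    · simp
    refine mul_le_mul_of_nonneg_left
      (add_le_add_left (Real.log_le_log (by exact_mod_cast hN0) ?_) 1) (Nat.cast_nonneg _)
    exact_mod_cast hN
  have h0 := le_log_growthFactor (m := m) hk
  have hid := logPrimitive_identity (show (0 : ℝ) < k by linarith) (show (0 : ℝ) < m by linarith)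
  have e1 := le_logSuperfactorial (k + m)
  have e2 := logSuperfactorial_le k
  have e3 := logSuperfactorial_le m
  have e4 := logSuperfactorial_le (2 * k + m)
  have e5 := le_logSuperfactorial (2 * k)
  have b1 := hE (k + m) (by omega)
  have b2 := hE k (by omega)
  have b3 := hE m (by omega)
  have b4 := hE (2 * k + m) (by omega)
  have b5 := hE (2 * k) (by omega)
  push_cast at *
  rw [← hL] at h0
  nlinarith [mul_nonneg (by linarith : (0 : ℝ) ≤ k) hL0, mul_nonneg (by linarith : (0 : ℝ) ≤ m) hL0]

theorem le_log_u_add {k m : ℕ} (hk : 1 ≤ k) (hm : 1 ≤ m) :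
    Real.log (u k) + (((k + m : ℕ) : ℝ) ^ 2 * f (k / (k + m : ℕ)) -
      15 * (k + m : ℕ) * (Real.log (2 * (k + m : ℕ)) + 1)) ≤ Real.log (u (k + m)) := by
  have hg : (0 : ℝ) < (growthFactor k m : ℝ) := by exact_mod_cast growthFactor_pos k m
  have hu : 0 < u k := one_pos.trans_le (one_le_u k)
  have h := Real.log_le_log (mul_pos hu hg) (u_mul_growthFactor_le k m)
  rw [Real.log_mul hu.ne' hg.ne'] at h
  have h2 := le_log_growthFactor_of_pos hk hm
  linarith

theorem continuousAt_f {x : ℝ} (hx : x ∈ Set.Ioo (0 : ℝ) 1) : ContinuousAt f x := by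
  obtain ⟨h0, h1⟩ := hx
  have e1 : x ≠ 0 := h0.ne'
  have e2 : 1 - x ≠ 0 := by linarith
  have e3 : 1 + x ≠ 0 := by linarith
  unfold f
  fun_prop (disch := assumption)

open Filter Topology in
theorem tendsto_log_error :
    Tendsto (fun n : ℕ => 15 * (Real.log (2 * (n : ℝ)) + 1) / (n : ℝ)) atTop (𝓝 0) := by
  have h1 : Tendsto (fun n : ℕ => 2 * (n : ℝ)) atTop atTop :=
    tendsto_natCast_atTop_atTop.const_mul_atTop two_pos
  have h2 := (Real.isLittleO_log_id_atTop.tendsto_div_nhds_zero.comp h1).const_mul 30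
  have h3 := (tendsto_const_div_atTop_nhds_zero_nat (15 : ℝ)).add h2
  simp only [mul_zero, add_zero] at h3
  refine h3.congr' ?_
  filter_upwards [eventually_ge_atTop 1] with n hn
  have : (0 : ℝ) < n := by exact_mod_cast hn
  simp only [Function.comp_apply, id]
  field_simp
  ring

open Filter Topology in
theorem tendsto_floor_mul_div {α : ℝ} (hα : 0 ≤ α) :
    Tendsto (fun n : ℕ => ((⌊α * n⌋₊ : ℕ) : ℝ) / n) atTop (𝓝 α) :=
  (tendsto_nat_floor_mul_div_atTop hα).comp tendsto_natCast_atTop_atTop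

open Filter Topology in
/-- The increment of `log u` between `⌊α n⌋` and `n` is eventually at least `c n²`
for every `c < f α`. -/
theorem eventually_le_log_u {α c : ℝ} (hα : α ∈ Set.Ioo (0 : ℝ) 1) (hc : c < f α) :
    ∀ᶠ n : ℕ in atTop, Real.log (u ⌊α * n⌋₊) + c * (n : ℝ) ^ 2 ≤ Real.log (u n) := by
  have hlim := tendsto_floor_mul_div hα.1.le
  have h1 := ((continuousAt_f hα).tendsto.comp hlim).sub tendsto_log_error
  rw [sub_zero] at h1
  filter_upwards [h1.eventually (lt_mem_nhds hc), hlim.eventually (lt_mem_nhds hα.1),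
    hlim.eventually (gt_mem_nhds hα.2), eventually_ge_atTop 1] with n hn hpos hlt hn1
  have hn0 : (0 : ℝ) < n := by exact_mod_cast hn1
  set k := ⌊α * n⌋₊
  have hk : 1 ≤ k := by
    rcases Nat.eq_zero_or_pos k with h | h
    · simp [h] at hpos
    · exact h
  have hkn : k < n := by
    rw [div_lt_one hn0] at hlt
    exact_mod_cast hlt
  have h2 := le_log_u_add hk (show 1 ≤ n - k by omega)
  rw [show k + (n - k) = n by omega] at h2
  simp only [Function.comp_apply] at hn
  have h3 := mul_le_mul_of_nonneg_right hn.le (sq_nonneg (n : ℝ))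
  have h4 : (f (k / n) - 15 * (Real.log (2 * (n : ℝ)) + 1) / n) * (n : ℝ) ^ 2 =
      (n : ℝ) ^ 2 * f (k / n) - 15 * n * (Real.log (2 * n) + 1) := by
    field_simp
  linarith

/-- A sequence whose increments between `⌊α n⌋` and `n` are at least `γ (1 - α²) n²` grows at
least like `γ n²`, up to a linear error. -/
theorem exists_sq_sub_le {a : ℕ → ℝ} (ha : ∀ n, 0 ≤ a n) {α γ : ℝ}
    (hα : α ∈ Set.Ioo (0 : ℝ) 1) {n₀ : ℕ}
    (h : ∀ n ≥ n₀, a ⌊α * n⌋₊ + γ * (1 - α ^ 2) * (n : ℝ) ^ 2 ≤ a n) :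
    ∃ M M₀ : ℝ, ∀ n : ℕ, γ * (n : ℝ) ^ 2 - M * n - M₀ ≤ a n := by
  obtain ⟨h0, h1⟩ := hα
  have hM : 2 * |γ| + 2 * |γ| / (1 - α) * α = 2 * |γ| / (1 - α) := by
    have : 1 - α ≠ 0 := by linarith
    field_simp
    ring
  have hM0 : 0 ≤ 2 * |γ| / (1 - α) := div_nonneg (by positivity) (by linarith)
  generalize 2 * |γ| / (1 - α) = M at hM hM0
  refine ⟨M, |γ| * (n₀ : ℝ) ^ 2, fun n => ?_⟩
  induction n using Nat.strong_induction_on with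
  | _ n ih =>
    have hnn : (0 : ℝ) ≤ n := Nat.cast_nonneg n
    have hMn : 0 ≤ M * n := mul_nonneg hM0 hnn
    rcases le_or_gt n n₀ with hn | hn
    · have h2 : (n : ℝ) ^ 2 ≤ (n₀ : ℝ) ^ 2 := by gcongr
      have h3 : γ * (n : ℝ) ^ 2 ≤ |γ| * (n : ℝ) ^ 2 := by gcongr; exact le_abs_self γ
      have h4 : |γ| * (n : ℝ) ^ 2 ≤ |γ| * (n₀ : ℝ) ^ 2 := by gcongr
      linarith [ha n]
    · have hn1 : (1 : ℝ) ≤ n := by exact_mod_cast (show 1 ≤ n by omega)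
      have hαn : 0 ≤ α * n := by positivity
      have hfl := Nat.floor_le hαn
      have hfl' := Nat.lt_floor_add_one (α * n)
      have hαn' : α * n < n := by nlinarith
      have hlt : ⌊α * (n : ℝ)⌋₊ < n := by exact_mod_cast hfl.trans_lt hαn'
      have h2 := ih _ hlt
      have h3 := h n hn.le
      generalize ⌊α * (n : ℝ)⌋₊ = k at *
      have hk0 : (0 : ℝ) ≤ k := Nat.cast_nonneg k
      have h4 : |(k : ℝ) ^ 2 - α ^ 2 * (n : ℝ) ^ 2| ≤ 2 * n := by
        rw [abs_le]
        constructor <;> nlinarith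
      have h5 : -(|γ| * (2 * n)) ≤ γ * ((k : ℝ) ^ 2 - α ^ 2 * (n : ℝ) ^ 2) := by
        refine le_trans (neg_le_neg ?_) (neg_abs_le _)
        rw [abs_mul]
        gcongr
      have h6 : M * k ≤ M * (α * n) := by gcongr
      have h7 : 2 * |γ| * n + M * α * n = M * n := by rw [← add_mul, hM]
      nlinarith

open Filter Topology in
theorem le_liminf_log_u {α γ : ℝ} (hα : α ∈ Set.Ioo (0 : ℝ) 1)
    (hγ : γ * (1 - α ^ 2) < f α) {c : ℝ} (hc : c < γ) :
    c ≤ liminf (fun n : ℕ => Real.log (u n) / (n : ℝ) ^ 2) atTop := by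
  obtain ⟨n₀, h⟩ := eventually_atTop.1 (eventually_le_log_u hα hγ)
  obtain ⟨M, M₀, hM⟩ := exists_sq_sub_le (a := fun n => Real.log (u n)) log_u_nonneg hα h
  have hbdd : IsBoundedUnder (· ≤ ·) atTop (fun n : ℕ => Real.log (u n) / (n : ℝ) ^ 2) :=
    isBoundedUnder_of ⟨1, fun n => div_le_one_of_le₀ (log_u_le n) (sq_nonneg _)⟩
  refine le_liminf_of_le hbdd.isCoboundedUnder_ge ?_
  have hlim : Tendsto (fun n : ℕ => γ - M / n - M₀ / n * (1 / n)) atTop (𝓝 (γ - 0 - 0 * 0)) :=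
    (tendsto_const_nhds.sub (tendsto_const_div_atTop_nhds_zero_nat M)).sub
      ((tendsto_const_div_atTop_nhds_zero_nat M₀).mul (tendsto_const_div_atTop_nhds_zero_nat 1))
  rw [mul_zero, sub_zero, sub_zero] at hlim
  filter_upwards [hlim.eventually (lt_mem_nhds hc), eventually_ge_atTop 1] with n hn hn1
  have hn0 : (0 : ℝ) < n := by exact_mod_cast hn1
  rw [le_div_iff₀ (by positivity)]
  have h2 := mul_le_mul_of_nonneg_right hn.le (sq_nonneg (n : ℝ))
  have h3 : (γ - M / n - M₀ / n * (1 / n)) * (n : ℝ) ^ 2 = γ * (n : ℝ) ^ 2 - M * n - M₀ := by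
    field_simp
  linarith [hM n]

/-- `liminf (1/n²) log u(n) ≥ γ`, where `γ = f(α)/(1−α²)` and `α` is the unique solution
in `(0,1)` of `2x·f(x) + (1−x²)·f′(x) = 0`. -/
theorem liminf_log_u_ge (α : ℝ) (hα : α ∈ Set.Ioo (0 : ℝ) 1)
    (hroot : 2 * α * f α + (1 - α ^ 2) * deriv f α = 0)
    (huniq : ∀ β ∈ Set.Ioo (0 : ℝ) 1,
      2 * β * f β + (1 - β ^ 2) * deriv f β = 0 → β = α)
    (γ : ℝ) (hγ : γ = f α / (1 - α ^ 2)) :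
    γ ≤ Filter.liminf (fun n : ℕ => Real.log (u n) / (n : ℝ) ^ 2) Filter.atTop := by
  refine le_of_forall_lt_imp_le_of_dense fun c hc => ?_
  obtain ⟨c', hc', hc'γ⟩ := exists_between hc
  have hpos : 0 < 1 - α ^ 2 := by nlinarith [hα.1, hα.2]
  refine le_liminf_log_u hα ?_ hc'
  rwa [hγ, lt_div_iff₀ hpos] at hc'γ
end

section
/- The function q(x) := (1−x)²·log(1−x) − (1+x)²·log(1+x) + 2x·log x + 2(1+x²)·log 2 has a unique zero α in the open interval (0,1), and this zero satisfies 0.4331 < α < 0.4332; moreover the constant γ := f(α)/(1−α²) satisfies 0.2032 < γ < 0.2033. -/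
/-- The function `q(x) = (1−x)² log(1−x) − (1+x)² log(1+x) + 2x log x + 2(1+x²) log 2`,
which equals `2x f(x) + (1−x²) f′(x)` on `(0,1)`. -/
noncomputable def q (x : ℝ) : ℝ :=
  (1 - x) ^ 2 * Real.log (1 - x) - (1 + x) ^ 2 * Real.log (1 + x)
    + 2 * x * Real.log x + 2 * (1 + x ^ 2) * Real.log 2

/-- The derivative of `q` on `(0, 1)`. -/
noncomputable def qDeriv (x : ℝ) : ℝ :=
  -2 * ((1 - x) * Real.log (1 - x)) - 2 * ((1 + x) * Real.log (1 + x)) + 2 * Real.log x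
    + 4 * x * Real.log 2

/-- The second derivative of `q` on `(0, 1)`. -/
noncomputable def qDeriv₂ (x : ℝ) : ℝ :=
  2 * Real.log (1 - x) - 2 * Real.log (1 + x) + 2 / x + 4 * Real.log 2

theorem hasDerivAt_q {x : ℝ} (h0 : 0 < x) (h1 : x < 1) : HasDerivAt q (qDeriv x) x := by
  have hx := hasDerivAt_id' x
  have hm : HasDerivAt (fun y : ℝ => 1 - y) (-1) x := hx.const_sub 1
  have hp : HasDerivAt (fun y : ℝ => 1 + y) 1 x := hx.const_add 1
  have hm0 : 1 - x ≠ 0 := by linarith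
  have hp0 : 1 + x ≠ 0 := by linarith
  have h := ((((hm.pow 2).mul (hm.log hm0)).sub ((hp.pow 2).mul (hp.log hp0))).add
    ((hx.const_mul 2).mul (hx.log h0.ne'))).add
    ((((hx.pow 2).const_add 1).const_mul 2).mul_const (Real.log 2))
  refine h.congr_deriv ?_
  simp only [qDeriv, Pi.pow_apply]
  field_simp
  ring

theorem hasDerivAt_qDeriv {x : ℝ} (h0 : 0 < x) (h1 : x < 1) :
    HasDerivAt qDeriv (qDeriv₂ x) x := by
  have hx := hasDerivAt_id' x
  have hm : HasDerivAt (fun y : ℝ => 1 - y) (-1) x := hx.const_sub 1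
  have hp : HasDerivAt (fun y : ℝ => 1 + y) 1 x := hx.const_add 1
  have hm0 : 1 - x ≠ 0 := by linarith
  have hp0 : 1 + x ≠ 0 := by linarith
  have h := ((((hm.mul (hm.log hm0)).const_mul (-2)).sub
    ((hp.mul (hp.log hp0)).const_mul 2)).add ((hx.log h0.ne').const_mul 2)).add
    ((hx.const_mul 4).mul_const (Real.log 2))
  refine h.congr_deriv ?_
  simp only [qDeriv₂]
  field_simp
  ring

theorem continuous_one_sub_mul_log : Continuous fun x : ℝ => (1 - x) * Real.log (1 - x) :=
  Real.continuous_mul_log.comp (continuous_const.sub continuous_id)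

theorem continuous_one_add_mul_log : Continuous fun x : ℝ => (1 + x) * Real.log (1 + x) :=
  Real.continuous_mul_log.comp (continuous_const.add continuous_id)

theorem continuous_q : Continuous q := by
  have hx := Real.continuous_mul_log
  have hm := continuous_one_sub_mul_log
  have hp := continuous_one_add_mul_log
  have h : q = fun x => (1 - x) * ((1 - x) * Real.log (1 - x))
      - (1 + x) * ((1 + x) * Real.log (1 + x)) + 2 * (x * Real.log x)
      + 2 * (1 + x ^ 2) * Real.log 2 := by
    funext x
    simp only [q]
    ring
  rw [h]
  fun_prop

theorem continuousOn_qDeriv : ContinuousOn qDeriv (Set.Ioi 0) := by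
  have hm := continuous_one_sub_mul_log.continuousOn (s := Set.Ioi 0)
  have hp := continuous_one_add_mul_log.continuousOn (s := Set.Ioi 0)
  have hx : ContinuousOn Real.log (Set.Ioi 0) :=
    Real.continuousOn_log.mono fun x hx => ne_of_gt hx
  unfold qDeriv
  fun_prop

theorem q_one : q 1 = 0 := by
  norm_num [q]

theorem qDeriv_one : qDeriv 1 = 0 := by
  norm_num [qDeriv]
  ring

theorem strictAntiOn_qDeriv₂ : StrictAntiOn qDeriv₂ (Set.Ioo 0 1) := by
  intro x hx y hy hxy
  have hm : Real.log (1 - y) < Real.log (1 - x) :=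
    Real.log_lt_log (by linarith [hy.2]) (by linarith)
  have hp : Real.log (1 + x) < Real.log (1 + y) :=
    Real.log_lt_log (by linarith [hx.1]) (by linarith)
  have hi : 2 / y < 2 / x := div_lt_div_of_pos_left two_pos hx.1 hxy
  simp only [qDeriv₂]
  linarith

/-- Since `q` and its derivative vanish at `1`, two zeros of `q` in `(0, 1)` would, by Rolle's
theorem, give two zeros of the second derivative, which is strictly decreasing. -/
theorem q_ne_zero_of_lt {a b : ℝ} (ha : 0 < a) (hab : a < b) (hb : b < 1) (hqa : q a = 0) :
    q b ≠ 0 := by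
  intro hqb
  obtain ⟨c, hc, hc'⟩ := exists_hasDerivAt_eq_zero hab continuous_q.continuousOn
    (hqa.trans hqb.symm) fun x hx => hasDerivAt_q (ha.trans hx.1) (hx.2.trans hb)
  obtain ⟨d, hd, hd'⟩ := exists_hasDerivAt_eq_zero hb continuous_q.continuousOn
    (hqb.trans q_one.symm) fun x hx => hasDerivAt_q ((ha.trans hab).trans hx.1) hx.2
  have hc0 : 0 < c := ha.trans hc.1
  have hcd : c < d := hc.2.trans hd.1
  obtain ⟨s, hs, hs'⟩ := exists_hasDerivAt_eq_zero hcd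
    (continuousOn_qDeriv.mono fun x hx => hc0.trans_le hx.1) (hc'.trans hd'.symm)
    fun x hx => hasDerivAt_qDeriv (hc0.trans hx.1) (hx.2.trans hd.2)
  obtain ⟨t, ht, ht'⟩ := exists_hasDerivAt_eq_zero hd.2
    (continuousOn_qDeriv.mono fun x hx => (hc0.trans hcd).trans_le hx.1)
    (hd'.trans qDeriv_one.symm)
    fun x hx => hasDerivAt_qDeriv ((hc0.trans hcd).trans hx.1) hx.2
  have h := strictAntiOn_qDeriv₂ ⟨hc0.trans hs.1, hs.2.trans hd.2⟩
    ⟨(hc0.trans hcd).trans ht.1, ht.2⟩ (hs.2.trans ht.1)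
  linarith

theorem q_zero_unique {a b : ℝ} (ha : a ∈ Set.Ioo (0 : ℝ) 1) (hb : b ∈ Set.Ioo (0 : ℝ) 1)
    (hqa : q a = 0) (hqb : q b = 0) : a = b := by
  rcases lt_trichotomy a b with h | h | h
  · exact absurd hqb (q_ne_zero_of_lt ha.1 h hb.2 hqa)
  · exact h
  · exact absurd hqa (q_ne_zero_of_lt hb.1 h ha.2 hqb)

theorem log_eq_log_half_add {x : ℝ} (hx : x ≠ 0) :
    Real.log x = Real.log (x / 2) + Real.log 2 := by
  rw [Real.log_div hx two_ne_zero]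
  ring

theorem log_eq_log_double_sub {x : ℝ} (hx : x ≠ 0) :
    Real.log x = Real.log (2 * x) - Real.log 2 := by
  rw [Real.log_mul two_ne_zero hx]
  ring

theorem log_04331_bounds :
    -0.836786661 < Real.log 0.4331 ∧ Real.log 0.4331 < -0.836786601 := by
  have h := abs_le.1 (Real.abs_log_sub_add_sum_range_le (x := 0.1338) (by norm_num [abs_lt]) 10)
  rw [log_eq_log_double_sub (by norm_num)]
  norm_num [Finset.sum_range_succ, abs_of_pos, abs_of_neg] at h ⊢
  constructor <;> linarith [h.1, h.2, Real.log_two_gt_d9, Real.log_two_lt_d9]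

theorem log_05669_bounds :
    -0.567572388 < Real.log 0.5669 ∧ Real.log 0.5669 < -0.567572328 := by
  have h := abs_le.1 (Real.abs_log_sub_add_sum_range_le (x := -0.1338) (by norm_num [abs_lt]) 10)
  rw [log_eq_log_double_sub (by norm_num)]
  norm_num [Finset.sum_range_succ, abs_of_pos, abs_of_neg] at h ⊢
  constructor <;> linarith [h.1, h.2, Real.log_two_gt_d9, Real.log_two_lt_d9]

theorem log_14331_bounds :
    0.359839900 < Real.log 1.4331 ∧ Real.log 1.4331 < 0.359839960 := by
  have h := abs_le.1 (Real.abs_log_sub_add_sum_range_le (x := 0.28345) (by norm_num [abs_lt]) 15)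
  rw [log_eq_log_half_add (by norm_num)]
  norm_num [Finset.sum_range_succ, abs_of_pos, abs_of_neg] at h ⊢
  constructor <;> linarith [h.1, h.2, Real.log_two_gt_d9, Real.log_two_lt_d9]

theorem log_04332_bounds :
    -0.836555794 < Real.log 0.4332 ∧ Real.log 0.4332 < -0.836555734 := by
  have h := abs_le.1 (Real.abs_log_sub_add_sum_range_le (x := 0.1336) (by norm_num [abs_lt]) 10)
  rw [log_eq_log_double_sub (by norm_num)]
  norm_num [Finset.sum_range_succ, abs_of_pos, abs_of_neg] at h ⊢
  constructor <;> linarith [h.1, h.2, Real.log_two_gt_d9, Real.log_two_lt_d9]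

theorem log_05668_bounds :
    -0.567748801 < Real.log 0.5668 ∧ Real.log 0.5668 < -0.567748741 := by
  have h := abs_le.1 (Real.abs_log_sub_add_sum_range_le (x := -0.1336) (by norm_num [abs_lt]) 10)
  rw [log_eq_log_double_sub (by norm_num)]
  norm_num [Finset.sum_range_succ, abs_of_pos, abs_of_neg] at h ⊢
  constructor <;> linarith [h.1, h.2, Real.log_two_gt_d9, Real.log_two_lt_d9]

theorem log_14332_bounds :
    0.359909676 < Real.log 1.4332 ∧ Real.log 1.4332 < 0.359909736 := by
  have h := abs_le.1 (Real.abs_log_sub_add_sum_range_le (x := 0.2834) (by norm_num [abs_lt]) 15)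
  rw [log_eq_log_half_add (by norm_num)]
  norm_num [Finset.sum_range_succ, abs_of_pos, abs_of_neg] at h ⊢
  constructor <;> linarith [h.1, h.2, Real.log_two_gt_d9, Real.log_two_lt_d9]

theorem q_04331_pos : 0 < q 0.4331 := by
  have h₁ := log_04331_bounds
  have h₂ := log_05669_bounds
  have h₃ := log_14331_bounds
  norm_num [q] at h₁ h₂ h₃ ⊢
  linarith [h₁.1, h₂.1, h₃.2, Real.log_two_gt_d9]

theorem q_04332_neg : q 0.4332 < 0 := by
  have h₁ := log_04332_bounds
  have h₂ := log_05668_bounds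
  have h₃ := log_14332_bounds
  norm_num [q] at h₁ h₂ h₃ ⊢
  linarith [h₁.2, h₂.2, h₃.1, Real.log_two_lt_d9]

theorem exists_q_eq_zero : ∃ a ∈ Set.Ioo (0.4331 : ℝ) 0.4332, q a = 0 :=
  intermediate_value_Ioo' (by norm_num) continuous_q.continuousOn ⟨q_04332_neg, q_04331_pos⟩

theorem f_div_eq_of_q_eq_zero {a : ℝ} (h0 : 0 < a) (h1 : a < 1) (ha : q a = 0) :
    f a / (1 - a ^ 2) =
      (a * Real.log a - (1 + a) * Real.log (1 + a) + (1 + a) * Real.log 2) / (1 - a) := by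
  have hm : 1 - a ≠ 0 := by linarith
  have hs : 1 - a ^ 2 ≠ 0 := by nlinarith
  rw [div_eq_div_iff hs hm]
  simp only [f, q] at ha ⊢
  linear_combination (-(1 - a) / 2) * ha

theorem mul_log_le_mul_log_add {c x : ℝ} (hc : 0 < c) (hx : 0 < x) :
    x * Real.log x ≤ x * (Real.log c + x / c - 1) := by
  have h := Real.log_le_sub_one_of_pos (div_pos hx hc)
  rw [Real.log_div hx.ne' hc.ne'] at h
  exact mul_le_mul_of_nonneg_left (by linarith) hx.le

theorem mul_log_add_sub_le_mul_log {c x : ℝ} (hc : 0 < c) (hx : 0 < x) :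
    x * Real.log c + x - c ≤ x * Real.log x := by
  have h := Real.log_le_sub_one_of_pos (div_pos hc hx)
  rw [Real.log_div hc.ne' hx.ne'] at h
  have h' := mul_le_mul_of_nonneg_left h hx.le
  rw [mul_sub, mul_sub, mul_div_cancel₀ _ hx.ne'] at h'
  linarith

theorem gamma_bounds {a : ℝ} (ha : a ∈ Set.Ioo (0.4331 : ℝ) 0.4332) (hq : q a = 0) :
    0.2032 < f a / (1 - a ^ 2) ∧ f a / (1 - a ^ 2) < 0.2033 := by
  obtain ⟨h₁, h₂⟩ := ha
  have ha0 : 0 < a := by linarith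
  have ha1 : a < 1 := by linarith
  rw [f_div_eq_of_q_eq_zero ha0 ha1 hq, lt_div_iff₀ (by linarith), div_lt_iff₀ (by linarith)]
  have hl := mul_log_add_sub_le_mul_log (c := 0.4332) (by norm_num) ha0
  have hu := mul_log_le_mul_log_add (c := 0.4332) (by norm_num) ha0
  have hl' := mul_log_add_sub_le_mul_log (c := 1.4332) (x := 1 + a) (by norm_num) (by linarith)
  have hu' := mul_log_le_mul_log_add (c := 1.4332) (x := 1 + a) (by norm_num) (by linarith)
  obtain ⟨hc, hc'⟩ := log_04332_bounds
  obtain ⟨hd, hd'⟩ := log_14332_bounds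
  have ht := Real.log_two_gt_d9
  have ht' := Real.log_two_lt_d9
  have hc₁ := mul_lt_mul_of_pos_left hc ha0
  have hc₂ := mul_lt_mul_of_pos_left hc' ha0
  have hd₁ := mul_lt_mul_of_pos_left hd (by linarith : 0 < 1 + a)
  have hd₂ := mul_lt_mul_of_pos_left hd' (by linarith : 0 < 1 + a)
  have ht₁ := mul_lt_mul_of_pos_left ht (by linarith : 0 < 1 + a)
  have ht₂ := mul_lt_mul_of_pos_left ht' (by linarith : 0 < 1 + a)
  have hs : 0 < (a - 0.4331) * (0.4332 - a) := mul_pos (by linarith) (by linarith)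
  ring_nf at *
  constructor <;> linarith

/-- `q` has a unique zero `α ∈ (0,1)`; it satisfies `0.4331 < α < 0.4332`, and
`γ = f(α)/(1−α²)` satisfies `0.2032 < γ < 0.2033`. -/
theorem alpha_gamma_bounds :
    (∃! a : ℝ, a ∈ Set.Ioo (0 : ℝ) 1 ∧ q a = 0) ∧
      ∀ a : ℝ, a ∈ Set.Ioo (0 : ℝ) 1 → q a = 0 →
        (0.4331 < a ∧ a < 0.4332) ∧
          (0.2032 < f a / (1 - a ^ 2) ∧ f a / (1 - a ^ 2) < 0.2033) := by
  obtain ⟨a, ha, hqa⟩ := exists_q_eq_zero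
  have ha' : a ∈ Set.Ioo (0 : ℝ) 1 := ⟨by linarith [ha.1], by linarith [ha.2]⟩
  refine ⟨⟨a, ⟨ha', hqa⟩, fun b hb => q_zero_unique hb.1 ha' hb.2 hqa⟩, fun b hb hqb => ?_⟩
  obtain rfl := q_zero_unique hb ha' hqb hqa
  exact ⟨ha, gamma_bounds ha hqb⟩
end
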